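/- Let 1 < ε₁ < ε₂ < ∞ and let f be a smooth function compactly supported in B_{ε₁,ε₂} ∩ U, where U = {x₃ > 0}. Let ε₁ ≤ ε ≤ ε₂ and δ = (ε²−1)/(2ε). If the apple transform 𝒜f(r,α,β) = 0 for all r ∈ [0,δ], α ∈ [0,2π], β ∈ [0,π], then f(x) = 0 for all x with 1 ≤ |x| ≤ ε. -/

import Mathlib

noncomputable section
open Real MeasureTheory Set

abbrev R3 := EuclideanSpace ℝ (Fin 3)

/-- The unit vector with spherical angles `θ` (azimuth) and `φ` (colatitude). -/
def sphVec (θ φ : ℝ) : R3 :=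
  (WithLp.equiv 2 (Fin 3 → ℝ)).symm ![sin φ * cos θ, sin φ * sin θ, cos φ]

/-- Rotation about the `x₃` axis by angle `α`. -/
def rotZ (α : ℝ) (x : R3) : R3 :=
  (WithLp.equiv 2 (Fin 3 → ℝ)).symm
    ![cos α * x 0 - sin α * x 1, sin α * x 0 + cos α * x 1, x 2]

/-- Rotation about the `x₂` axis by angle `β`. -/
def rotY (β : ℝ) (x : R3) : R3 :=
  (WithLp.equiv 2 (Fin 3 → ℝ)).symm
    ![cos β * x 0 + sin β * x 2, x 1, -sin β * x 0 + cos β * x 2]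

/-- `h = U(α)V(β)`. -/
def rotUV (α β : ℝ) (x : R3) : R3 := rotZ α (rotY β x)

/-- The hollow ball `B_{a,b} = {x ∈ ℝ³ : a < |x| < b}`. -/
def hollowBall (a b : ℝ) : Set R3 := {x : R3 | a < ‖x‖ ∧ ‖x‖ < b}

/-- The open upper half space `U = {x₃ > 0}`. -/
def upperHalf : Set R3 := {x : R3 | 0 < x 2}

/-- The apple transform `𝒜f`. -/
def appleT (f : R3 → ℝ) (r α β : ℝ) : ℝ :=
  ∫ θ in (0:ℝ)..(2 * π), ∫ φ in (0:ℝ)..π,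
    (Real.sqrt (r ^ 2 * sin φ ^ 2 + 1) + r * sin φ) ^ 2 * sin φ *
      Real.sqrt ((1 + r ^ 2) / (1 + r ^ 2 * sin φ ^ 2)) *
      f ((Real.sqrt (r ^ 2 * sin φ ^ 2 + 1) + r * sin φ) • rotUV α β (sphVec θ φ))

/-- A bounded measurable function vanishing off a set of finite measure is integrable. -/
theorem integrable_of_bounded_support {X : Type*} [MeasurableSpace X] {μ : Measure X}
    {g : X → ℝ} (hg : Measurable g) {B : Set X} (hB : MeasurableSet B) (hμ : μ B < ⊤) {C : ℝ}
    (hC : ∀ x, |g x| ≤ C) (h0 : ∀ x, x ∉ B → g x = 0) : Integrable g μ := by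
  have h : g = B.indicator g := by
    funext x
    by_cases hx : x ∈ B
    · rw [indicator_of_mem hx]
    · rw [indicator_of_notMem hx, h0 x hx]
  rw [h, integrable_indicator_iff hB]
  exact Measure.integrableOn_of_bounded hμ.ne hg.aestronglyMeasurable
    (M := C) (ae_of_all _ fun x => by simpa using hC x)

theorem norm_sq_R3 (x : R3) : ‖x‖ ^ 2 = x 0 ^ 2 + x 1 ^ 2 + x 2 ^ 2 := by
  rw [EuclideanSpace.norm_sq_eq, Fin.sum_univ_three]; simp

theorem norm_sphVec (θ φ : ℝ) : ‖sphVec θ φ‖ = 1 := by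
  have h : ‖sphVec θ φ‖ ^ 2 = 1 := by
    rw [norm_sq_R3]
    simp only [sphVec, WithLp.equiv_symm_apply, Matrix.cons_val]
    nlinarith [sin_sq_add_cos_sq θ, sin_sq_add_cos_sq φ]
  nlinarith [norm_nonneg (sphVec θ φ)]

/-- The point of `ℝ³` with third coordinate `q.1` and horizontal coordinates `q.2`. -/
def ofHeight (q : ℝ × ℝ × ℝ) : R3 := !₂[q.2.1, q.2.2, q.1]

theorem measurable_ofHeight : Measurable ofHeight := by
  unfold ofHeight
  refine (WithLp.measurable_toLp 2 (Fin 3 → ℝ)).comp (measurable_pi_iff.2 fun i => ?_)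
  fin_cases i <;> simp <;> fun_prop

theorem measurePreserving_ofHeight : MeasurePreserving ofHeight := by
  have h1 := EuclideanSpace.volume_preserving_symm_measurableEquiv_toLp (Fin 3)
  have h2 := volume_preserving_piFinSuccAbove (fun _ : Fin 3 => ℝ) 2
  have h3 := volume_preserving_finTwoArrow ℝ
  have h4 := ((MeasurePreserving.id (volume : Measure ℝ)).prod h3.symm)
  have h5 := h1.symm.comp (h2.symm.comp h4)
  convert h5 using 1
  · funext q
    ext i
    fin_cases i <;> rfl
  · rfl

/-- Integration over the half plane `{(z, d) : 0 < d}` in polar coordinates. -/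
theorem integral_halfPlane (G : ℝ × ℝ → ℝ) :
    ∫ p in univ ×ˢ Ioi (0 : ℝ), G p =
      ∫ p in Ioi (0 : ℝ) ×ˢ Ioo 0 π, p.1 * G (p.1 * cos p.2, p.1 * sin p.2) := by
  have hm : MeasurableSet ((univ : Set ℝ) ×ˢ Ioi (0 : ℝ)) :=
    MeasurableSet.univ.prod measurableSet_Ioi
  rw [← integral_indicator hm, ← integral_comp_polarCoord_symm]
  have hsub : Ioi (0 : ℝ) ×ˢ Ioo 0 π ⊆ polarCoord.target := by
    rintro ⟨a, b⟩ ⟨ha, hb⟩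
    exact ⟨ha, by linarith [hb.1, pi_pos], hb.2⟩
  rw [setIntegral_eq_of_subset_of_forall_sdiff_eq_zero (s := Ioi (0 : ℝ) ×ˢ Ioo 0 π)
    polarCoord.open_target.measurableSet hsub]
  · refine setIntegral_congr_fun (measurableSet_Ioi.prod measurableSet_Ioo) ?_
    rintro ⟨a, b⟩ ⟨ha, hb⟩
    have : (0 : ℝ) < a * sin b := mul_pos ha (sin_pos_of_mem_Ioo hb)
    simp [polarCoord, indicator, this]
  · rintro ⟨a, b⟩ ⟨⟨ha, hb⟩, hn⟩
    have hb' : b ≤ 0 := by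
      by_contra! h
      exact hn ⟨ha, h, hb.2⟩
    have : ¬ (0 : ℝ) < a * sin b := by
      have := sin_nonpos_of_nonpos_of_neg_pi_le hb' hb.1.le
      exact not_lt.2 (mul_nonpos_of_nonneg_of_nonpos (le_of_lt ha) this)
    simp [polarCoord, indicator, this]

theorem integral_spherical {g : R3 → ℝ} (hg : Measurable g) {C R : ℝ} (hC : ∀ x, |g x| ≤ C)
    (hR : ∀ x, R < ‖x‖ → g x = 0) :
    ∫ x, g x = ∫ θ in Ioo (-π) π, ∫ φ in Ioo 0 π, ∫ ρ in Ioi (0 : ℝ),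
      ρ ^ 2 * sin φ * g (ρ • sphVec θ φ) := by
  have hR0 : ∀ x, |R| < ‖x‖ → g x = 0 := fun x hx => hR x ((le_abs_self R).trans_lt hx)
  have hC0 : 0 ≤ C := (abs_nonneg _).trans (hC 0)
  have key : ∀ z d θ : ℝ, ‖ofHeight (z, d * cos θ, d * sin θ)‖ ^ 2 = z ^ 2 + d ^ 2 := by
    intro z d θ
    rw [norm_sq_R3]
    simp only [ofHeight, Matrix.cons_val]
    nlinarith [sin_sq_add_cos_sq θ]
  have habs : ∀ z d θ : ℝ, z ∉ Icc (-|R|) |R| ∨ d ∉ Icc (-|R|) |R| →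
      g (ofHeight (z, d * cos θ, d * sin θ)) = 0 := by
    intro z d θ h
    apply hR0
    by_contra! hle
    have h1 : z ^ 2 + d ^ 2 ≤ |R| ^ 2 := by
      rw [← key z d θ]; gcongr
    rcases h with h | h <;> apply h <;> rw [mem_Icc, ← abs_le] <;>
      apply abs_le_of_sq_le_sq' _ (abs_nonneg R) |> abs_le.2 <;> nlinarith
  set F : ℝ → ℝ × ℝ → ℝ := fun z p => p.1 * g (ofHeight (z, p.1 * cos p.2, p.1 * sin p.2)) with hF
  have hFm : Measurable fun q : ℝ × ℝ × ℝ => F q.1 q.2 := by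
    simp only [hF]
    exact (by fun_prop : Measurable fun q : ℝ × ℝ × ℝ => q.2.1).mul
      (hg.comp (measurable_ofHeight.comp (by fun_prop)))
  have hFb : ∀ z p, |F z p| ≤ |R| * C := by
    intro z p
    by_cases hp : p.1 ∈ Icc (-|R|) |R|
    · rw [hF]; simp only [abs_mul]
      exact mul_le_mul (abs_le.2 hp) (hC _) (abs_nonneg _) (abs_nonneg _)
    · simp only [hF, habs z p.1 p.2 (Or.inr hp), mul_zero, abs_zero]; positivity
  have hF0 : ∀ z p, z ∉ Icc (-|R|) |R| ∨ p.1 ∉ Icc (-|R|) |R| → F z p = 0 := by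
    intro z p h
    simp only [hF, habs z p.1 p.2 h, mul_zero]
  have hint : Integrable (fun q : ℝ × ℝ × ℝ => F q.1 q.2)
      ((volume : Measure ℝ).prod ((volume.restrict (Ioi 0)).prod (volume.restrict (Ioo (-π) π)))) := by
    refine integrable_of_bounded_support hFm (B := Icc (-|R|) |R| ×ˢ Icc (-|R|) |R| ×ˢ univ)
      (measurableSet_Icc.prod (measurableSet_Icc.prod .univ)) ?_ (fun q => hFb q.1 q.2) ?_
    · rw [Measure.prod_prod, Measure.prod_prod]
      refine ENNReal.mul_lt_top (by simp) (ENNReal.mul_lt_top ?_ (by simp))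
      exact (Measure.restrict_apply_le _ _).trans_lt (by simp)
    · rintro ⟨z, p⟩ h
      apply hF0
      by_contra! h'
      exact h ⟨h'.1, h'.2, trivial⟩
  have hint2 : ∀ θ, Integrable (fun q : ℝ × ℝ => F q.1 (q.2, θ))
      ((volume : Measure ℝ).prod (volume.restrict (Ioi 0))) := by
    intro θ
    refine integrable_of_bounded_support (hFm.comp (g := fun q : ℝ × ℝ × ℝ => F q.1 q.2)
      (f := fun q : ℝ × ℝ => (q.1, q.2, θ)) (by fun_prop))
      (B := Icc (-|R|) |R| ×ˢ Icc (-|R|) |R|)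
      (measurableSet_Icc.prod measurableSet_Icc) ?_ (fun q => hFb q.1 _) ?_
    · rw [Measure.prod_prod]
      refine ENNReal.mul_lt_top (by simp) ?_
      exact (Measure.restrict_apply_le _ _).trans_lt (by simp)
    · rintro ⟨z, p⟩ h
      apply hF0
      by_contra! h'
      exact h ⟨h'.1, h'.2⟩
  have h1 : ∫ x, g x = ∫ z, ∫ p in Ioi (0:ℝ) ×ˢ Ioo (-π) π, F z p := by
    rw [← measurePreserving_ofHeight.map_eq,
      integral_map measurePreserving_ofHeight.measurable.aemeasurable hg.aestronglyMeasurable]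
    rw [Measure.volume_eq_prod, integral_prod]
    · congr 1; funext z
      rw [← integral_comp_polarCoord_symm]
      rfl
    · rw [← Measure.volume_eq_prod]
      refine (measurePreserving_ofHeight.integrable_comp hg.aestronglyMeasurable).2 ?_
      refine integrable_of_bounded_support hg (B := Metric.closedBall 0 |R|) measurableSet_closedBall
        measure_closedBall_lt_top hC fun x hx => hR0 x ?_
      simpa using hx
  rw [h1]
  have h2 : ∀ z, ∫ p in Ioi (0:ℝ) ×ˢ Ioo (-π) π, F z p =
      ∫ p, F z p ∂((volume.restrict (Ioi 0)).prod (volume.restrict (Ioo (-π) π))) := by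
    intro z
    rw [Measure.prod_restrict, ← Measure.volume_eq_prod]
  simp_rw [h2]
  rw [integral_integral_swap (f := F) hint, integral_prod_symm _ hint.integral_prod_right]
  congr 1; funext θ
  rw [← integral_integral_swap (f := fun z d => F z (d, θ)) (hint2 θ),
    ← integral_prod (fun q : ℝ × ℝ => F q.1 (q.2, θ)) (hint2 θ)]
  have hμ : (volume : Measure ℝ).prod (volume.restrict (Ioi (0 : ℝ))) =
      volume.restrict (univ ×ˢ Ioi (0 : ℝ)) := by
    rw [Measure.volume_eq_prod, ← Measure.prod_restrict, Measure.restrict_univ]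
  have h0 : ∀ p : ℝ × ℝ, p.1 ∉ Icc (-|R|) |R| → F (p.1 * cos p.2) (p.1 * sin p.2, θ) = 0 := by
    intro p hp
    simp only [hF]
    rw [hR0, mul_zero]
    by_contra! hle
    refine hp (abs_le.1 (abs_le_of_sq_le_sq ?_ (abs_nonneg R)))
    calc p.1 ^ 2 = (p.1 * cos p.2) ^ 2 + (p.1 * sin p.2) ^ 2 := by
          nlinarith [sin_sq_add_cos_sq p.2]
      _ ≤ _ := by rw [← key _ _ θ]; gcongr
  rw [hμ, integral_halfPlane, Measure.volume_eq_prod, ← Measure.prod_restrict, integral_prod_symm]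
  · refine setIntegral_congr_fun measurableSet_Ioo fun φ _ => ?_
    refine setIntegral_congr_fun measurableSet_Ioi fun ρ _ => ?_
    simp only [hF]
    have : ofHeight (ρ * cos φ, ρ * sin φ * cos θ, ρ * sin φ * sin θ) = ρ • sphVec θ φ := by
      ext i
      fin_cases i <;> simp [ofHeight, sphVec] <;> ring
    rw [this]; ring
  · refine integrable_of_bounded_support (C := |R| * (|R| * C)) (B := Icc (-|R|) |R| ×ˢ univ)
      (measurable_fst.mul (hFm.comp (g := fun q : ℝ × ℝ × ℝ => F q.1 q.2)
      (f := fun q : ℝ × ℝ => (q.1 * cos q.2, q.1 * sin q.2, θ)) (by fun_prop)))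
      (measurableSet_Icc.prod .univ) ?_ ?_ ?_
    · rw [Measure.prod_prod]
      refine ENNReal.mul_lt_top ?_ (by simp)
      exact (Measure.restrict_apply_le _ _).trans_lt (by simp)
    · intro p
      by_cases hp : p.1 ∈ Icc (-|R|) |R|
      · rw [abs_mul]
        exact mul_le_mul (abs_le.2 hp) (hFb _ _) (abs_nonneg _) (abs_nonneg _)
      · rw [h0 p hp, mul_zero, abs_zero]; positivity
    · intro p hp
      rw [h0 p (fun h => hp ⟨h, trivial⟩), mul_zero]

theorem hasDerivAt_max_pow (n : ℕ) (y : ℝ) :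
    HasDerivAt (fun y : ℝ => max y 0 ^ (n + 2)) ((n + 2 : ℕ) * max y 0 ^ (n + 1)) y := by
  rcases lt_trichotomy y 0 with h | rfl | h
  · have : (fun y : ℝ => max y 0 ^ (n + 2)) =ᶠ[nhds y] fun _ => 0 := by
      filter_upwards [Iio_mem_nhds h] with z hz
      simp [max_eq_right (show z ≤ 0 from le_of_lt (mem_Iio.1 hz))]
    rw [max_eq_right h.le]
    simpa using! (hasDerivAt_const y (0 : ℝ)).congr_of_eventuallyEq this
  · rw [hasDerivAt_iff_isLittleO_nhds_zero]
    simp only [zero_add, max_self, ne_eq, Nat.add_eq_zero_iff, one_ne_zero, OfNat.ofNat_ne_zero,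
      and_false, not_false_eq_true, zero_pow, mul_zero, smul_zero, sub_zero]
    refine Asymptotics.IsBigO.trans_isLittleO (g := fun h : ℝ => h ^ (n + 2)) ?_ ?_
    · refine Asymptotics.IsBigO.of_bound 1 (Filter.Eventually.of_forall fun h => ?_)
      rw [one_mul, norm_pow, norm_pow]
      gcongr
      rw [Real.norm_eq_abs, Real.norm_eq_abs, abs_of_nonneg (le_max_right _ _)]
      exact max_le (le_abs_self _) (abs_nonneg _)
    · simpa using! Asymptotics.isLittleO_pow_pow (𝕜 := ℝ) (show 1 < n + 2 by omega)
  · have : (fun y : ℝ => max y 0 ^ (n + 2)) =ᶠ[nhds y] fun y => y ^ (n + 2) := by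
      filter_upwards [Ioi_mem_nhds h] with z hz
      rw [max_eq_left (le_of_lt hz)]
    rw [max_eq_left h.le]
    exact (hasDerivAt_pow (n + 2) y).congr_of_eventuallyEq this

section TruncatedMoments

variable {X : Type*} [MeasurableSpace X] {μ : Measure X} {G σ : X → ℝ}

theorem integrable_truncated (hG : Integrable G μ) (hσ : Measurable σ) (hσ0 : ∀ x, 0 ≤ σ x)
    (j : ℕ) (c : ℝ) : Integrable (fun x => G x * max (c - σ x) 0 ^ j) μ := by
  refine hG.mul_bdd (c := |c| ^ j) ?_ (ae_of_all _ fun x => ?_)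
  · exact (by fun_prop : Measurable fun x => max (c - σ x) 0 ^ j).aestronglyMeasurable
  · rw [norm_pow, Real.norm_eq_abs, abs_of_nonneg (le_max_right _ _)]
    gcongr
    exact max_le (by linarith [hσ0 x, le_abs_self c]) (abs_nonneg _)

theorem hasDerivAt_truncatedMoment (hG : Integrable G μ) (hσ : Measurable σ)
    (hσ0 : ∀ x, 0 ≤ σ x) (n : ℕ) (c : ℝ) :
    HasDerivAt (fun c => ∫ x, G x * max (c - σ x) 0 ^ (n + 2) ∂μ)
      ((n + 2 : ℕ) * ∫ x, G x * max (c - σ x) 0 ^ (n + 1) ∂μ) c := by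
  rw [← integral_const_mul]
  refine (hasDerivAt_integral_of_dominated_loc_of_deriv_le (s := Metric.ball c 1)
    (F' := fun c x => (n + 2 : ℕ) * (G x * max (c - σ x) 0 ^ (n + 1)))
    (bound := fun x => (n + 2 : ℕ) * (|G x| * (|c| + 1) ^ (n + 1)))
    (Metric.ball_mem_nhds c one_pos) ?_ (integrable_truncated hG hσ hσ0 _ c)
    ((integrable_truncated hG hσ hσ0 _ c).const_mul _).aestronglyMeasurable ?_ ?_ ?_).2
  · exact Filter.Eventually.of_forall fun c =>
      (integrable_truncated hG hσ hσ0 _ c).aestronglyMeasurable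
  · refine ae_of_all _ fun x y hy => ?_
    rw [Metric.mem_ball, Real.dist_eq] at hy
    have hy' : |y| ≤ |c| + 1 := by
      have := abs_sub_abs_le_abs_sub y c
      linarith
    rw [norm_mul, norm_mul, norm_pow, Real.norm_natCast, Real.norm_eq_abs (G x),
      Real.norm_eq_abs (max _ _), abs_of_nonneg (le_max_right (y - σ x) 0)]
    gcongr
    exact max_le (by linarith [hσ0 x, le_abs_self y]) (by positivity)
  · exact (hG.abs.mul_const _).const_mul _
  · refine ae_of_all _ fun x y _ => ?_
    have h := (hasDerivAt_max_pow n (y - σ x)).comp y ((hasDerivAt_id y).sub_const (σ x))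
    have h := h.const_mul (G x)
    rw [show ((n + 2 : ℕ) : ℝ) * (G x * max (y - σ x) 0 ^ (n + 1)) =
      G x * ((n + 2 : ℕ) * max (y - σ x) 0 ^ (n + 1) * 1) by ring]
    exact h

/-- A truncated-moment relation of Euler type forces the first truncated moment to vanish. -/
theorem truncatedMoment_one_eq_zero (hG : Integrable G μ) (hσ : Measurable σ)
    (hσ0 : ∀ x, 0 ≤ σ x) {c₁ c₀ : ℝ} (hc₁ : 0 < c₁) (hsupp : ∀ x, G x ≠ 0 → c₁ ≤ σ x)
    {p : ℕ} {Q : ℕ → ℝ} (hQ : Q 0 ≠ 0)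
    (hrel : ∀ c, 0 < c → c ≤ c₀ → ∑ i ∈ Finset.range (p + 1), Q i * c⁻¹ ^ i *
      ∫ x, G x * max (c - σ x) 0 ^ (i + 1) ∂μ = 0) {c : ℝ} (hc : c ≤ c₀) :
    ∫ x, G x * max (c - σ x) 0 ∂μ = 0 := by
  set U : ℕ → ℝ → ℝ := fun j c => ∫ x, G x * max (c - σ x) 0 ^ j ∂μ with hU
  have hlow : ∀ j c, c ≤ c₁ → U (j + 1) c = 0 := by
    intro j c hc
    refine integral_eq_zero_of_ae (ae_of_all _ fun x => ?_)
    by_cases hx : G x = 0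
    · simp [hx]
    · have : max (c - σ x) 0 = 0 := max_eq_right (by linarith [hsupp x hx])
      simp [this]
  suffices h : U 1 c = 0 by simpa [hU] using h
  rcases le_total c c₁ with h1 | h1
  · exact hlow 0 c h1
  set Y : ℝ → Fin p → ℝ := fun c i => U (i + 2) c with hY
  set Y' : ℝ → Fin p → ℝ := fun c i => (i + 2 : ℕ) * U (i + 1) c with hY'
  have hder : ∀ c, HasDerivAt Y (Y' c) c := fun c =>
    hasDerivAt_pi.2 fun i => hasDerivAt_truncatedMoment hG hσ hσ0 i c
  set K₀ : ℝ := ∑ i ∈ Finset.range p, |Q (i + 1) / Q 0| * c₁⁻¹ ^ (i + 1) with hK₀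
  have hK₀n : 0 ≤ K₀ := Finset.sum_nonneg fun i _ => by positivity
  have hU1 : ∀ c, c₁ ≤ c → c ≤ c₀ → |U 1 c| ≤ K₀ * ‖Y c‖ := by
    intro c h1 h2
    have hr := hrel c (hc₁.trans_le h1) h2
    rw [Finset.sum_range_succ'] at hr
    have he : U 1 c = -∑ i ∈ Finset.range p, (Q (i + 1) / Q 0) * c⁻¹ ^ (i + 1) * U (i + 2) c := by
      have : Q 0 * U 1 c = -∑ i ∈ Finset.range p, Q (i + 1) * c⁻¹ ^ (i + 1) * U (i + 2) c := by
        simp only [pow_zero, mul_one, zero_add] at hr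
        simp only [hU]
        linarith
      rw [← mul_right_inj' hQ, this, mul_neg, Finset.mul_sum]
      congr 1
      refine Finset.sum_congr rfl fun i _ => ?_
      field_simp
    rw [he, abs_neg, hK₀, Finset.sum_mul]
    refine (Finset.abs_sum_le_sum_abs _ _).trans (Finset.sum_le_sum fun i hi => ?_)
    rw [abs_mul, abs_mul]
    have hc : 0 < c := hc₁.trans_le h1
    have hn : |U (i + 2) c| ≤ ‖Y c‖ := norm_le_pi_norm (Y c) ⟨i, Finset.mem_range.1 hi⟩
    rw [abs_of_pos (by positivity : 0 < c⁻¹ ^ (i + 1))]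
    gcongr
  have hYc : Y c = 0 := by
    have hg := norm_le_gronwallBound_of_norm_deriv_right_le (f := Y) (f' := Y') (δ := 0)
      (K := (p + 2 : ℕ) * (1 + K₀)) (ε := 0) (a := c₁) (b := c₀)
      (fun c _ => (hder c).continuousAt.continuousWithinAt) (fun c _ => (hder c).hasDerivWithinAt)
      ?_ ?_ c ⟨h1, hc⟩
    · rw [gronwallBound_ε0_δ0] at hg
      exact norm_le_zero_iff.1 hg
    · rw [norm_le_zero_iff]
      funext i
      exact hlow _ _ le_rfl
    · rintro y ⟨hy1, hy2⟩
      rw [add_zero]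
      refine (pi_norm_le_iff_of_nonneg (by positivity)).2 fun i => ?_
      simp only [hY', norm_mul, Real.norm_natCast]
      have hb : ‖U (i + 1) y‖ ≤ (1 + K₀) * ‖Y y‖ := by
        rcases i with ⟨_ | i, hi⟩
        · refine (hU1 y hy1 hy2.le).trans ?_
          gcongr
          linarith
        · refine (norm_le_pi_norm (Y y) ⟨i, by omega⟩).trans ?_
          nlinarith [norm_nonneg (Y y)]
      rw [mul_assoc]
      gcongr
      exact i.2.le
  have := hU1 c h1 hc
  rw [hYc, norm_zero, mul_zero] at this
  exact abs_eq_zero.1 (le_antisymm this (abs_nonneg _))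

theorem integral_Iio_eq_zero (hG : Integrable G μ) (hσ : Measurable σ) {c₀ : ℝ}
    (h : ∀ c ≤ c₀, ∫ x, G x * max (c - σ x) 0 ∂μ = 0) (hσ0 : ∀ x, 0 ≤ σ x) {c : ℝ} (hc : c ≤ c₀) :
    ∫ x, G x * (Iio c).indicator 1 (σ x) ∂μ = 0 := by
  set φ : ℕ → X → ℝ := fun n x =>
    (n : ℝ) * (max (c - σ x) 0 - max (c - 1 / n - σ x) 0) with hφ
  have hz : ∀ n : ℕ, ∫ x, G x * φ n x ∂μ = 0 := by
    intro n
    have h1 := h c hc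
    have h2 := h (c - 1 / n) (by
      have : (0 : ℝ) ≤ 1 / n := by positivity
      linarith)
    have i1 := integrable_truncated hG hσ hσ0 1 c
    have i2 := integrable_truncated hG hσ hσ0 1 (c - 1 / n)
    simp only [pow_one] at i1 i2
    calc ∫ x, G x * φ n x ∂μ
        = ∫ x, (n : ℝ) * (G x * max (c - σ x) 0 - G x * max (c - 1 / n - σ x) 0) ∂μ := by
          congr 1; funext x; simp only [hφ]; ring
      _ = 0 := by rw [integral_const_mul, integral_sub i1 i2, h1, h2]; simp
  have ht := tendsto_integral_of_dominated_convergence (μ := μ) (F := fun n x => G x * φ n x)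
    (f := fun x => G x * (Iio c).indicator 1 (σ x)) (fun x => |G x|) ?_ hG.abs ?_ ?_
  · simp only [hz] at ht
    exact tendsto_nhds_unique ht tendsto_const_nhds
  · intro n
    exact hG.aestronglyMeasurable.mul
      (by fun_prop : Measurable (φ n)).aestronglyMeasurable
  · intro n
    refine ae_of_all _ fun x => ?_
    rw [norm_mul, Real.norm_eq_abs, Real.norm_eq_abs]
    refine mul_le_of_le_one_right (abs_nonneg _) ?_
    rcases Nat.eq_zero_or_pos n with rfl | hn
    · simp [hφ]
    have hn' : (0 : ℝ) < n := by exact_mod_cast hn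
    have hm : |max (c - σ x) 0 - max (c - 1 / n - σ x) 0| ≤ 1 / n := by
      refine (abs_max_sub_max_le_abs _ _ _).trans ?_
      rw [show c - σ x - (c - 1 / n - σ x) = 1 / (n : ℝ) by ring, abs_of_pos (by positivity)]
    simp only [hφ, abs_mul, Nat.abs_cast]
    calc (n : ℝ) * _ ≤ n * (1 / n) := by gcongr
      _ = 1 := by field_simp
  · refine ae_of_all _ fun x => Filter.Tendsto.const_mul _ ?_
    by_cases hx : σ x < c
    · rw [indicator_of_mem (show σ x ∈ Iio c from hx)]
      have he : ∀ᶠ n : ℕ in Filter.atTop, φ n x = 1 := by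
        obtain ⟨N, hN⟩ := exists_nat_one_div_lt (sub_pos.2 hx)
        filter_upwards [Filter.eventually_gt_atTop N] with n hn
        have hn' : (N : ℝ) + 1 ≤ n := by exact_mod_cast hn
        have hn0 : (0 : ℝ) < n := by linarith [(Nat.cast_nonneg N : (0 : ℝ) ≤ N)]
        have h3 : 1 / (n : ℝ) ≤ 1 / (N + 1) := by gcongr
        simp only [hφ]
        rw [max_eq_left (by linarith), max_eq_left (by linarith)]
        field_simp
        ring
      exact tendsto_const_nhds.congr' (by filter_upwards [he] with n hn using hn.symm)
    · rw [indicator_of_notMem (show σ x ∉ Iio c from hx)]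
      have : ∀ n, φ n x = 0 := by
        intro n
        have h0 : (0 : ℝ) ≤ 1 / n := by positivity
        push Not at hx
        simp only [hφ]
        rw [max_eq_right (by linarith), max_eq_right (by linarith)]
        simp
      simp only [this]
      exact tendsto_const_nhds

/-- A density whose integrals over all sublevel sets of `σ` vanish is orthogonal to every
function of `σ`. -/
theorem integral_comp_eq_zero (hGm : Measurable G) (hG : Integrable G μ) (hσ : Measurable σ)
    (h : ∀ c, ∫ x, G x * (Iio c).indicator 1 (σ x) ∂μ = 0) (hz : ∫ x, G x ∂μ = 0)
    {q : ℝ → ℝ} (hq : Measurable q) (hi : Integrable (fun x => G x * q (σ x)) μ) :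
    ∫ x, G x * q (σ x) ∂μ = 0 := by
  set P : X → NNReal := fun x => (G x).toNNReal with hP
  set N : X → NNReal := fun x => (-G x).toNNReal with hN
  have hPm : Measurable P := hGm.real_toNNReal
  have hNm : Measurable N := hGm.neg.real_toNNReal
  have hfin : ∀ (ν : Measure X) (H : X → ℝ), Integrable H ν →
      ∫⁻ x, ENNReal.ofReal (H x) ∂ν ≠ ⊤ := fun ν H hH =>
    ((lintegral_mono fun x => Real.ofReal_le_enorm (H x)).trans_lt hH.2).ne
  have hν : (μ.withDensity fun x => (P x : ENNReal)).map σ =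
      (μ.withDensity fun x => (N x : ENNReal)).map σ := by
    have : IsFiniteMeasure (μ.withDensity fun x => (P x : ENNReal)) :=
      isFiniteMeasure_withDensity (hfin μ G hG)
    refine Measure.ext_of_Ici _ _ fun a => ?_
    have hs : MeasurableSet (σ ⁻¹' Ici a) := hσ measurableSet_Ici
    rw [Measure.map_apply hσ measurableSet_Ici, Measure.map_apply hσ measurableSet_Ici,
      withDensity_apply _ hs, withDensity_apply _ hs]
    have h0 : ∫ x in σ ⁻¹' Ici a, G x ∂μ = 0 := by
      have hc := integral_add_compl hs hG
      have : ∫ x in (σ ⁻¹' Ici a)ᶜ, G x ∂μ = 0 := by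
        rw [← integral_indicator hs.compl, ← h a]
        congr 1; funext x
        by_cases hx : σ x < a <;> simp [indicator, hx]
      linarith
    rw [integral_eq_lintegral_pos_part_sub_lintegral_neg_part hG.integrableOn, sub_eq_zero] at h0
    exact (ENNReal.toReal_eq_toReal_iff' (hfin _ _ hG.integrableOn)
      (hfin _ _ hG.neg.integrableOn)).1 h0
  have e := congrArg (fun ν => ∫ y, q y ∂ν) hν
  rw [integral_map hσ.aemeasurable hq.aestronglyMeasurable,
    integral_map hσ.aemeasurable hq.aestronglyMeasurable,
    integral_withDensity_eq_integral_smul hPm, integral_withDensity_eq_integral_smul hNm] at e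
  have hsplit : ∀ x, G x * q (σ x) = P x • q (σ x) - N x • q (σ x) := by
    intro x
    simp only [hP, hN, NNReal.smul_def, smul_eq_mul, ← sub_mul, Real.coe_toNNReal']
    congr 1
    rcases le_total (G x) 0 with hx | hx <;> simp [hx]
  have hiP : Integrable (fun x => P x • q (σ x)) μ := by
    refine hi.mono ((hPm.smul (hq.comp hσ)).aestronglyMeasurable) (ae_of_all _ fun x => ?_)
    rw [NNReal.smul_def, norm_smul, norm_mul]
    gcongr
    simp only [hP, Real.coe_toNNReal', Real.norm_eq_abs, abs_of_nonneg (le_max_right (G x) 0)]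
    exact max_le (le_abs_self _) (abs_nonneg _)
  have hiN : Integrable (fun x => N x • q (σ x)) μ := by
    refine hi.mono ((hNm.smul (hq.comp hσ)).aestronglyMeasurable) (ae_of_all _ fun x => ?_)
    rw [NNReal.smul_def, norm_smul, norm_mul]
    gcongr
    simp only [hN, Real.coe_toNNReal', Real.norm_eq_abs, abs_of_nonneg (le_max_right (-G x) 0)]
    exact max_le (neg_le_abs _) (abs_nonneg _)
  simp only [hsplit]
  rw [integral_sub hiP hiN, e, sub_self]

end TruncatedMoments

theorem integral_comp_eq_zero_of_truncated {X : Type*} [MeasurableSpace X] {μ : Measure X}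
    {G σ : X → ℝ} (hGm : Measurable G) (hG : Integrable G μ) (hσ : Measurable σ)
    (hσ0 : ∀ x, 0 ≤ σ x) {c₀ : ℝ} (h : ∀ c ≤ c₀, ∫ x, G x * max (c - σ x) 0 ∂μ = 0)
    {q : ℝ → ℝ} (hq : Measurable q) (hq0 : ∀ y, c₀ ≤ y → q y = 0)
    (hi : Integrable (fun x => G x * q (σ x)) μ) :
    ∫ x, G x * q (σ x) ∂μ = 0 := by
  set G' : X → ℝ := fun x => G x * (Iio c₀).indicator 1 (σ x) with hG'
  have hind : Measurable fun x => (Iio c₀).indicator (1 : ℝ → ℝ) (σ x) :=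
    (measurable_one.indicator measurableSet_Iio).comp hσ
  have he : ∀ x, G' x * q (σ x) = G x * q (σ x) := by
    intro x
    by_cases hx : σ x < c₀
    · simp [hG', hx]
    · simp [hq0 _ (not_lt.1 hx)]
  have hG'i : Integrable G' μ := by
    refine hG.mul_bdd (c := 1) hind.aestronglyMeasurable (ae_of_all _ fun x => ?_)
    by_cases hx : σ x < c₀ <;> simp [hx]
  simp only [← he] at hi ⊢
  refine integral_comp_eq_zero (hGm.mul hind) hG'i hσ (fun c => ?_)
    (integral_Iio_eq_zero hG hσ h hσ0 le_rfl) hq hi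
  rw [← integral_Iio_eq_zero hG hσ h hσ0 (min_le_right c c₀)]
  congr 1; funext x
  by_cases h1 : σ x < c <;> by_cases h2 : σ x < c₀ <;> simp [h1, h2]

theorem integral_cos_pow_add_two (n : ℕ) :
    ∫ θ in (-π)..π, cos θ ^ (n + 2) = (n + 1) / (n + 2) * ∫ θ in (-π)..π, cos θ ^ n := by
  rw [integral_cos_pow]
  simp

theorem integral_cos_pow_odd (j : ℕ) : ∫ θ in (-π)..π, cos θ ^ (2 * j + 1) = 0 := by
  induction j with
  | zero => simp
  | succ j ih => rw [show 2 * (j + 1) + 1 = 2 * j + 1 + 2 by ring, integral_cos_pow_add_two, ih,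
      mul_zero]

theorem integral_cos_pow_even_pos (j : ℕ) : 0 < ∫ θ in (-π)..π, cos θ ^ (2 * j) := by
  induction j with
  | zero => simp; positivity
  | succ j ih =>
    rw [show 2 * (j + 1) = 2 * j + 2 by ring, integral_cos_pow_add_two]
    positivity

theorem sum_range_even {F : ℕ → ℝ} (h : ∀ j, F (2 * j + 1) = 0) (p : ℕ) :
    ∑ i ∈ Finset.range (2 * p + 1), F i = ∑ j ∈ Finset.range (p + 1), F (2 * j) := by
  induction p with
  | zero => simp
  | succ p ih =>
    rw [show 2 * (p + 1) + 1 = 2 * p + 1 + 1 + 1 by ring, Finset.sum_range_succ,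
      Finset.sum_range_succ, ih, h, add_zero, Finset.sum_range_succ _ (p + 1)]
    rfl

/-- The moments of the semicircle density. -/
def semicircleMoment (i : ℕ) : ℝ := ∫ t in (-1 : ℝ)..1, t ^ (2 * i) * √(1 - t ^ 2)

theorem semicircleMoment_zero_pos : 0 < semicircleMoment 0 := by
  unfold semicircleMoment
  refine intervalIntegral.intervalIntegral_pos_of_pos_on
    (Continuous.intervalIntegrable (by fun_prop) _ _) (fun t ht => ?_) (by norm_num)
  have : 0 < 1 - t ^ 2 := by nlinarith [ht.1, ht.2]
  simpa using this

theorem integral_pow_mul_sqrt {c y : ℝ} (hc : 0 < c) (hy : 0 ≤ y) (i : ℕ) :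
    ∫ t in (-1 : ℝ)..1, (t ^ 2) ^ i * √(c - y - c * t ^ 2) =
      semicircleMoment i / √c * (c⁻¹ ^ i * max (c - y) 0 ^ (i + 1)) := by
  rcases le_total c y with h | h
  · rw [max_eq_right (by linarith)]
    have : ∀ t : ℝ, √(c - y - c * t ^ 2) = 0 := fun t =>
      Real.sqrt_eq_zero_of_nonpos (by nlinarith [sq_nonneg t])
    simp [this]
  rw [max_eq_left (by linarith)]
  rcases h.eq_or_lt with rfl | h
  · have : ∀ t : ℝ, √(y - y - y * t ^ 2) = 0 := fun t =>
      Real.sqrt_eq_zero_of_nonpos (by nlinarith [sq_nonneg t])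
    simp only [this]
    simp
  have hz : 0 < c - y := by linarith
  set l := √((c - y) / c) with hl
  have hl2 : l ^ 2 = (c - y) / c := Real.sq_sqrt (by positivity)
  have hl0 : 0 < l := Real.sqrt_pos.2 (by positivity)
  have hl1 : l ≤ 1 := Real.sqrt_le_one.2 ((div_le_one hc).2 (by linarith))
  have hout : ∀ t : ℝ, l ≤ |t| → (t ^ 2) ^ i * √(c - y - c * t ^ 2) = 0 := by
    intro t ht
    rw [Real.sqrt_eq_zero_of_nonpos, mul_zero]
    have h1 : l ^ 2 ≤ t ^ 2 := by rw [← sq_abs t]; gcongr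
    rw [hl2, div_le_iff₀ hc] at h1
    linarith
  have hcont : Continuous fun t : ℝ => (t ^ 2) ^ i * √(c - y - c * t ^ 2) := by fun_prop
  have hint := fun a b => hcont.intervalIntegrable (μ := volume) a b
  have e1 : ∫ t in (-1 : ℝ)..(-l), (t ^ 2) ^ i * √(c - y - c * t ^ 2) = 0 := by
    rw [intervalIntegral.integral_congr (g := fun _ => 0), intervalIntegral.integral_zero]
    intro t ht
    rw [uIcc_of_le (by linarith)] at ht
    exact hout t (by rw [abs_of_nonpos (by linarith [ht.2])]; linarith [ht.2])
  have e2 : ∫ t in l..1, (t ^ 2) ^ i * √(c - y - c * t ^ 2) = 0 := by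
    rw [intervalIntegral.integral_congr (g := fun _ => 0), intervalIntegral.integral_zero]
    intro t ht
    rw [uIcc_of_le hl1] at ht
    exact hout t (by rw [abs_of_nonneg (by linarith [ht.1])]; exact ht.1)
  rw [← intervalIntegral.integral_add_adjacent_intervals (hint (-1) (-l)) (hint (-l) 1),
    ← intervalIntegral.integral_add_adjacent_intervals (hint (-l) l) (hint l 1), e1, e2,
    zero_add, add_zero]
  have hs := intervalIntegral.smul_integral_comp_mul_right (a := -1) (b := 1)
    (fun t : ℝ => (t ^ 2) ^ i * √(c - y - c * t ^ 2)) l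
  rw [neg_one_mul, one_mul] at hs
  rw [← hs, semicircleMoment, smul_eq_mul]
  have hfun : ∀ t : ℝ, ((t * l) ^ 2) ^ i * √(c - y - c * (t * l) ^ 2) =
      ((l ^ 2) ^ i * √(c - y)) * (t ^ (2 * i) * √(1 - t ^ 2)) := by
    intro t
    rw [show c - y - c * (t * l) ^ 2 = (c - y) * (1 - t ^ 2) by rw [mul_pow, hl2]; field_simp,
      Real.sqrt_mul hz.le, mul_pow, mul_pow, ← pow_mul t]
    ring
  simp only [hfun]
  rw [intervalIntegral.integral_const_mul]
  have hlc : l * √(c - y) = (c - y) / √c := by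
    rw [hl, Real.sqrt_div hz.le, div_mul_eq_mul_div, Real.mul_self_sqrt hz.le]
  calc _ = (l ^ 2) ^ i * (l * √(c - y)) * ∫ t in (-1 : ℝ)..1, t ^ (2 * i) * √(1 - t ^ 2) := by ring
    _ = _ := by
      rw [hlc, hl2, div_pow, inv_pow]; ring

/-- Integrating an even polynomial against `√(c - y - c t²)` yields a truncated polynomial. -/
theorem integral_eval_mul_sqrt {c y : ℝ} (hc : 0 < c) (hy : 0 ≤ y) (M : Polynomial ℝ) {p : ℕ}
    (hM : M.natDegree ≤ p) :
    ∫ t in (-1 : ℝ)..1, M.eval (t ^ 2) * √(c - y - c * t ^ 2) =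
      ∑ i ∈ Finset.range (p + 1), M.coeff i *
        (semicircleMoment i / √c * (c⁻¹ ^ i * max (c - y) 0 ^ (i + 1))) := by
  simp only [Polynomial.eval_eq_sum_range' (Nat.lt_succ_of_le hM), Finset.sum_mul]
  rw [intervalIntegral.integral_finsetSum]
  · refine Finset.sum_congr rfl fun i _ => ?_
    rw [← integral_pow_mul_sqrt hc hy, ← intervalIntegral.integral_const_mul]
    simp only [mul_assoc]
  · exact fun i _ => Continuous.intervalIntegrable (by fun_prop) _ _

theorem inner_R3 (x y : R3) : inner ℝ x y = x 0 * y 0 + x 1 * y 1 + x 2 * y 2 := by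
  rw [PiLp.inner_apply, Fin.sum_univ_three]
  simp
  ring

/-- Rotation about the `x₃` axis as a linear isometry. -/
def rotZIso (α : ℝ) : R3 ≃ₗᵢ[ℝ] R3 :=
  LinearIsometry.toLinearIsometryEquiv
    { toFun := rotZ α
      map_add' := fun x y => by ext i; fin_cases i <;> simp [rotZ] <;> ring
      map_smul' := fun a x => by ext i; fin_cases i <;> simp [rotZ] <;> ring
      norm_map' := fun x => by
        rw [← sq_eq_sq₀ (norm_nonneg _) (norm_nonneg _)]
        simp only [LinearMap.coe_mk, AddHom.coe_mk, norm_sq_R3]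
        simp [rotZ]
        linear_combination (x 0 ^ 2 + x 1 ^ 2) * sin_sq_add_cos_sq α } rfl

/-- Rotation about the `x₂` axis as a linear isometry. -/
def rotYIso (β : ℝ) : R3 ≃ₗᵢ[ℝ] R3 :=
  LinearIsometry.toLinearIsometryEquiv
    { toFun := rotY β
      map_add' := fun x y => by ext i; fin_cases i <;> simp [rotY] <;> ring
      map_smul' := fun a x => by ext i; fin_cases i <;> simp [rotY] <;> ring
      norm_map' := fun x => by
        rw [← sq_eq_sq₀ (norm_nonneg _) (norm_nonneg _)]
        simp only [LinearMap.coe_mk, AddHom.coe_mk, norm_sq_R3]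
        simp [rotY]
        linear_combination (x 0 ^ 2 + x 2 ^ 2) * sin_sq_add_cos_sq β } rfl

theorem rotZIso_apply (α : ℝ) (x : R3) : rotZIso α x = rotZ α x := rfl

/-- `rotUV α β` as a linear isometry. -/
def rotUVIso (α β : ℝ) : R3 ≃ₗᵢ[ℝ] R3 := (rotYIso β).trans (rotZIso α)

theorem rotUVIso_apply (α β : ℝ) (x : R3) : rotUVIso α β x = rotUV α β x := rfl

/-- The north pole. -/
def northPole : R3 := !₂[0, 0, 1]

theorem inner_northPole (x : R3) : inner ℝ northPole x = x 2 := by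
  rw [inner_R3]; simp [northPole]

/-- Every pair of reals is of the form `(h cos γ, h sin γ)`. -/
theorem exists_polar (a b : ℝ) :
    ∃ γ ∈ Icc 0 (2 * π), a = √(a ^ 2 + b ^ 2) * cos γ ∧ b = √(a ^ 2 + b ^ 2) * sin γ := by
  have h : ∃ γ, a = √(a ^ 2 + b ^ 2) * cos γ ∧ b = √(a ^ 2 + b ^ 2) * sin γ := by
    refine ⟨Complex.arg ⟨a, b⟩, ?_⟩
    have hn : ‖(⟨a, b⟩ : ℂ)‖ = √(a ^ 2 + b ^ 2) := by
      rw [Complex.norm_eq_sqrt_sq_add_sq]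
    rw [← hn]
    exact ⟨(Complex.norm_mul_cos_arg ⟨a, b⟩).symm, (Complex.norm_mul_sin_arg ⟨a, b⟩).symm⟩
  obtain ⟨γ, h1, h2⟩ := h
  refine ⟨toIcoMod two_pi_pos 0 γ, ?_, ?_⟩
  · have := toIcoMod_mem_Ico two_pi_pos 0 γ
    rw [zero_add] at this
    exact Ico_subset_Icc_self this
  · have e : toIcoMod two_pi_pos 0 γ = γ - toIcoDiv two_pi_pos 0 γ * (2 * π) := by
      rw [toIcoMod, zsmul_eq_mul]
    rw [e, cos_sub_int_mul_two_pi, sin_sub_int_mul_two_pi]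
    exact ⟨h1, h2⟩

theorem exists_rotUV_northPole {e : R3} (he : ‖e‖ = 1) :
    ∃ α ∈ Icc 0 (2 * π), ∃ β ∈ Icc 0 π, rotUV α β northPole = e := by
  obtain ⟨α, hα, h0, h1⟩ := exists_polar (e 0) (e 1)
  have hs : e 0 ^ 2 + e 1 ^ 2 + e 2 ^ 2 = 1 := by rw [← norm_sq_R3, he, one_pow]
  have h2 : -1 ≤ e 2 ∧ e 2 ≤ 1 := by constructor <;> nlinarith [sq_nonneg (e 0), sq_nonneg (e 1)]
  have hsin : sin (arccos (e 2)) = √(e 0 ^ 2 + e 1 ^ 2) := by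
    rw [sin_arccos]; congr 1; linarith
  refine ⟨α, hα, arccos (e 2), ⟨arccos_nonneg _, arccos_le_pi _⟩, ?_⟩
  ext i
  fin_cases i
  · simp [rotUV, rotY, rotZ, northPole, hsin]; linarith
  · simp [rotUV, rotY, rotZ, northPole, hsin]; linarith
  · simp [rotUV, rotY, rotZ, northPole, cos_arccos h2.1 h2.2]

/-- Orthonormal coordinates whose third axis is `e` and in which `b` has no second component. -/
theorem exists_adapted_isometry {e : R3} (he : ‖e‖ = 1) (b : R3) :
    ∃ T : R3 ≃ₗᵢ[ℝ] R3, (∀ x, inner ℝ e (T x) = x 2) ∧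
      ∀ x, inner ℝ b (T x) = inner ℝ b e * x 2 + √(‖b‖ ^ 2 - inner ℝ b e ^ 2) * x 0 := by
  obtain ⟨α, -, β, -, hQ⟩ := exists_rotUV_northPole he
  set Q := rotUVIso α β with hQd
  have hQe : Q northPole = e := hQ
  set b' := Q.symm b with hb'
  have hbb : Q b' = b := Q.apply_symm_apply b
  obtain ⟨γ, -, h0, h1⟩ := exists_polar (b' 0) (b' 1)
  have hin : inner ℝ b e = b' 2 := by
    rw [← hbb, ← hQe, Q.inner_map_map, real_inner_comm, inner_northPole]
  have hn : ‖b‖ ^ 2 - inner ℝ b e ^ 2 = b' 0 ^ 2 + b' 1 ^ 2 := by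
    rw [hin, ← hbb, Q.norm_map, norm_sq_R3]; ring
  refine ⟨(rotZIso γ).trans Q, fun x => ?_, fun x => ?_⟩
  · rw [← hQe, LinearIsometryEquiv.trans_apply, Q.inner_map_map, inner_northPole, rotZIso_apply]
    simp [rotZ]
  · rw [LinearIsometryEquiv.trans_apply, hn, hin, ← hbb, Q.inner_map_map, inner_R3, rotZIso_apply]
    simp only [rotZ, WithLp.equiv_symm_apply, Matrix.cons_val]
    generalize √(b' 0 ^ 2 + b' 1 ^ 2) = h at *
    rw [h0, h1]
    linear_combination h * x 0 * sin_sq_add_cos_sq γ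

theorem integral_comp_isometry (T : R3 ≃ₗᵢ[ℝ] R3) (g : R3 → ℝ) :
    ∫ x, g (T x) = ∫ x, g x :=
  T.measurePreserving.integral_comp T.toHomeomorph.measurableEmbedding g

/-- The integral over the unit ball of an even power times a zonal function. -/
theorem integral_ball_inner_pow_mul_zonal {e : R3} (he : ‖e‖ = 1) (b : R3) (p : ℕ) {κ : ℝ → ℝ}
    (hκ : Continuous κ) {C : ℝ} (hC : ∀ y, 0 ≤ y → |κ y| ≤ C) :
    ∫ x, (Metric.closedBall (0 : R3) 1).indicator 1 x *
        (inner ℝ b x ^ (2 * p) * κ ((inner ℝ e x / ‖x‖) ^ 2)) =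
      (2 * p + 3 : ℝ)⁻¹ * ∑ j ∈ Finset.range (p + 1), (2 * p).choose (2 * j) *
        (inner ℝ b e ^ (2 * (p - j)) * (‖b‖ ^ 2 - inner ℝ b e ^ 2) ^ j) *
        (∫ θ in (-π)..π, cos θ ^ (2 * j)) *
        ∫ t in (-1 : ℝ)..1, (t ^ 2) ^ (p - j) * (1 - t ^ 2) ^ j * κ (t ^ 2) := by
  obtain ⟨T, hT1, hT2⟩ := exists_adapted_isometry he b
  have hb : inner ℝ b e ^ 2 ≤ ‖b‖ ^ 2 := by
    have := abs_real_inner_le_norm b e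
    rw [he, mul_one] at this
    rw [← sq_abs]; gcongr
  set v : ℝ := inner ℝ b e with hv
  set h : ℝ := √(‖b‖ ^ 2 - v ^ 2) with hh
  have hh2 : h ^ 2 = ‖b‖ ^ 2 - v ^ 2 := Real.sq_sqrt (by linarith)
  rw [← integral_comp_isometry T]
  simp only [hT1, hT2, T.norm_map]
  have hTb : ∀ x, (Metric.closedBall (0 : R3) 1).indicator (1 : R3 → ℝ) (T x) =
      (Metric.closedBall (0 : R3) 1).indicator 1 x := by
    intro x; simp [indicator]
  simp only [hTb]
  have hm : Measurable fun x : R3 => (Metric.closedBall (0 : R3) 1).indicator (1 : R3 → ℝ) x *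
      ((v * x 2 + h * x 0) ^ (2 * p) * κ ((x 2 / ‖x‖) ^ 2)) :=
    (measurable_one.indicator measurableSet_closedBall).mul (Measurable.mul (by fun_prop)
      (hκ.measurable.comp (by fun_prop)))
  have hcoord : ∀ (x : R3) i, |x i| ≤ ‖x‖ := fun x i => by simpa using! PiLp.norm_apply_le x i
  rw [integral_spherical hm (C := (|v| + |h|) ^ (2 * p) * C) (R := 1)]
  rotate_left
  · intro x
    have hC0 : 0 ≤ C := (abs_nonneg _).trans (hC 0 le_rfl)
    by_cases hx : x ∈ Metric.closedBall (0 : R3) 1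
    · have hx1 : ‖x‖ ≤ 1 := by simpa using hx
      rw [indicator_of_mem hx, Pi.one_apply, one_mul, abs_mul, abs_pow]
      have : |v * x 2 + h * x 0| ≤ |v| + |h| := by
        refine (abs_add_le _ _).trans ?_
        rw [abs_mul, abs_mul]
        have a1 := (hcoord x 2).trans hx1
        have a2 := (hcoord x 0).trans hx1
        nlinarith [abs_nonneg v, abs_nonneg h]
      gcongr
      exact hC _ (by positivity)
    · rw [indicator_of_notMem hx, zero_mul, abs_zero]; positivity
  · intro x hx
    rw [indicator_of_notMem (by simpa using hx), zero_mul]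
  have hρ : ∀ θ φ, φ ∈ Ioo 0 π → ∫ ρ in Ioi (0 : ℝ), ρ ^ 2 * sin φ *
      ((Metric.closedBall (0 : R3) 1).indicator (1 : R3 → ℝ) (ρ • sphVec θ φ) *
      ((v * (ρ • sphVec θ φ) 2 + h * (ρ • sphVec θ φ) 0) ^ (2 * p) *
        κ (((ρ • sphVec θ φ) 2 / ‖ρ • sphVec θ φ‖) ^ 2))) =
      (2 * p + 3 : ℝ)⁻¹ * (sin φ * ((v * cos φ + h * (sin φ * cos θ)) ^ (2 * p) *
        κ (cos φ ^ 2))) := by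
    intro θ φ _
    have e1 : ∀ ρ ∈ Ioi (0 : ℝ), ρ ^ 2 * sin φ *
      ((Metric.closedBall (0 : R3) 1).indicator (1 : R3 → ℝ) (ρ • sphVec θ φ) *
      ((v * (ρ • sphVec θ φ) 2 + h * (ρ • sphVec θ φ) 0) ^ (2 * p) *
        κ (((ρ • sphVec θ φ) 2 / ‖ρ • sphVec θ φ‖) ^ 2))) =
      (Iic 1).indicator (fun ρ => ρ ^ (2 * p + 2) * (sin φ *
        ((v * cos φ + h * (sin φ * cos θ)) ^ (2 * p) * κ (cos φ ^ 2)))) ρ := by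
      intro ρ hρ
      have hρ0 : 0 < ρ := hρ
      have hnorm : ‖ρ • sphVec θ φ‖ = ρ := by
        rw [norm_smul, norm_sphVec, mul_one, Real.norm_eq_abs, abs_of_pos hρ0]
      have c0 : (ρ • sphVec θ φ) 0 = ρ * (sin φ * cos θ) := by simp [sphVec]
      have c2 : (ρ • sphVec θ φ) 2 = ρ * cos φ := by simp [sphVec]
      rw [hnorm, c0, c2, mul_div_cancel_left₀ _ hρ0.ne']
      by_cases h1 : ρ ≤ 1
      · rw [indicator_of_mem (by simpa [hnorm] using h1), indicator_of_mem (by exact h1),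
          Pi.one_apply, show v * (ρ * cos φ) + h * (ρ * (sin φ * cos θ)) =
            ρ * (v * cos φ + h * (sin φ * cos θ)) by ring, mul_pow]
        ring
      · rw [indicator_of_notMem (by simpa [hnorm] using h1), indicator_of_notMem (by exact h1)]
        ring
    rw [setIntegral_congr_fun measurableSet_Ioi e1, setIntegral_indicator measurableSet_Iic,
      Ioi_inter_Iic, ← intervalIntegral.integral_of_le zero_le_one,
      intervalIntegral.integral_mul_const, integral_pow]
    congr 1
    push_cast
    simp
    ring
  have e2 : ∀ θ, ∫ φ in Ioo 0 π, ∫ ρ in Ioi (0 : ℝ), ρ ^ 2 * sin φ *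
      ((Metric.closedBall (0 : R3) 1).indicator (1 : R3 → ℝ) (ρ • sphVec θ φ) *
      ((v * (ρ • sphVec θ φ) 2 + h * (ρ • sphVec θ φ) 0) ^ (2 * p) *
        κ (((ρ • sphVec θ φ) 2 / ‖ρ • sphVec θ φ‖) ^ 2))) =
      ∑ i ∈ Finset.range (2 * p + 1), cos θ ^ i * ((2 * p + 3 : ℝ)⁻¹ * ((2 * p).choose i *
        (h ^ i * v ^ (2 * p - i)) * ∫ φ in (0 : ℝ)..π,
          sin φ * (sin φ ^ i * cos φ ^ (2 * p - i) * κ (cos φ ^ 2)))) := by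
    intro θ
    rw [setIntegral_congr_fun measurableSet_Ioo (hρ θ), ← integral_Ioc_eq_integral_Ioo,
      ← intervalIntegral.integral_of_le pi_pos.le]
    simp only [← intervalIntegral.integral_const_mul]
    rw [← intervalIntegral.integral_finsetSum]
    · congr 1; funext φ
      rw [add_comm (v * cos φ), add_pow, Finset.sum_mul, Finset.mul_sum, Finset.mul_sum]
      refine Finset.sum_congr rfl fun i _ => ?_
      rw [mul_pow, mul_pow, mul_pow]
      ring
    · exact fun i _ => Continuous.intervalIntegrable (by fun_prop) _ _
  simp only [e2]
  rw [← integral_Ioc_eq_integral_Ioo, ← intervalIntegral.integral_of_le (by linarith [pi_pos]),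
    intervalIntegral.integral_finsetSum
      (fun i _ => Continuous.intervalIntegrable (by fun_prop) _ _)]
  simp only [intervalIntegral.integral_mul_const]
  rw [sum_range_even (fun j => by rw [integral_cos_pow_odd, zero_mul]), Finset.mul_sum]
  refine Finset.sum_congr rfl fun j hj => ?_
  have hjp : j ≤ p := Nat.lt_succ_iff.1 (Finset.mem_range.1 hj)
  have e3 : ∫ φ in (0 : ℝ)..π, sin φ * (sin φ ^ (2 * j) * cos φ ^ (2 * p - 2 * j) *
      κ (cos φ ^ 2)) =
      ∫ t in (-1 : ℝ)..1, (t ^ 2) ^ (p - j) * (1 - t ^ 2) ^ j * κ (t ^ 2) := by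
    have := intervalIntegral.integral_comp_mul_deriv (a := 0) (b := π) (f := cos)
      (f' := fun φ => -sin φ) (g := fun t => (t ^ 2) ^ (p - j) * (1 - t ^ 2) ^ j * κ (t ^ 2))
      (fun x _ => hasDerivAt_cos x) (by fun_prop) (by fun_prop)
    rw [cos_zero, cos_pi, intervalIntegral.integral_symm (-1) 1] at this
    rw [← neg_inj, ← this, ← intervalIntegral.integral_neg]
    congr 1; funext φ
    simp only [Function.comp]
    rw [show 1 - cos φ ^ 2 = sin φ ^ 2 by linarith [sin_sq_add_cos_sq φ], ← pow_mul, ← pow_mul,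
      Nat.mul_sub]
    ring
  rw [e3, ← hh2, ← pow_mul h, Nat.mul_sub]
  ring

section ZonalInversion

variable {F σ : R3 → ℝ}

/-- Averaging zonal relations over all axes against an even power of a linear form. -/
theorem integral_zonal_average_eq_zero (hF : Integrable F) (hσ : Measurable σ)
    (hσ0 : ∀ x, 0 ≤ σ x) {c : ℝ} (hc : 0 < c)
    (hV : ∀ n : R3, ‖n‖ = 1 → ∫ x, F x * √(c - σ x - c * (inner ℝ n x / ‖x‖) ^ 2) = 0)
    (b : R3) (p : ℕ) :
    ∫ x, F x * ∑ j ∈ Finset.range (p + 1), (2 * p).choose (2 * j) *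
        ((inner ℝ b x / ‖x‖) ^ (2 * (p - j)) * (‖b‖ ^ 2 - (inner ℝ b x / ‖x‖) ^ 2) ^ j) *
        (∫ θ in (-π)..π, cos θ ^ (2 * j)) *
        ∫ t in (-1 : ℝ)..1, (t ^ 2) ^ (p - j) * (1 - t ^ 2) ^ j * √(c - σ x - c * t ^ 2) = 0 := by
  set h : R3 → ℝ := fun N => (Metric.closedBall (0 : R3) 1).indicator 1 N *
    inner ℝ b N ^ (2 * p) with hh
  set k : R3 → R3 → ℝ := fun x N => √(c - σ x - c * (inner ℝ N x / (‖x‖ * ‖N‖)) ^ 2) with hk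
  have hne : ∀ᵐ x : R3, x ≠ 0 := by
    rw [ae_iff]; simp
  have hhm : Measurable h := (measurable_one.indicator measurableSet_closedBall).mul (by fun_prop)
  have hhi : Integrable h := by
    refine integrable_of_bounded_support hhm (B := Metric.closedBall 0 1)
      (C := ‖b‖ ^ (2 * p)) measurableSet_closedBall measure_closedBall_lt_top (fun x => ?_)
      (fun x hx => ?_)
    · by_cases hx : x ∈ Metric.closedBall (0 : R3) 1
      · have hx1 : ‖x‖ ≤ 1 := by simpa using hx
        simp only [hh]
        rw [indicator_of_mem hx, Pi.one_apply, one_mul, abs_pow]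
        gcongr
        exact (abs_real_inner_le_norm b x).trans (mul_le_of_le_one_right (norm_nonneg _) hx1)
      · simp only [hh]
        rw [indicator_of_notMem hx, zero_mul, abs_zero]; positivity
    · simp only [hh]
      rw [indicator_of_notMem hx, zero_mul]
  have hint : Integrable (Function.uncurry fun x N => F x * h N * k x N)
      ((volume : Measure R3).prod volume) := by
    refine (hF.mul_prod hhi).mul_bdd (c := √c) ?_ (ae_of_all _ fun z => ?_)
    · have : Measurable fun z : R3 × R3 => k z.1 z.2 := by
        simp only [hk]
        fun_prop
      exact this.aestronglyMeasurable
    · rw [Real.norm_eq_abs, abs_of_nonneg (Real.sqrt_nonneg _)]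
      refine Real.sqrt_le_sqrt ?_
      have := hσ0 z.1
      have : 0 ≤ c * (inner ℝ z.2 z.1 / (‖z.1‖ * ‖z.2‖)) ^ 2 := by positivity
      linarith
  have hswap := integral_integral_swap hint
  have hR : ∫ N, ∫ x, F x * h N * k x N = 0 := by
    refine integral_eq_zero_of_ae ?_
    filter_upwards [hne] with N hN
    have hN0 : ‖N‖ ≠ 0 := norm_ne_zero_iff.2 hN
    have := hV (‖N‖⁻¹ • N) (by rw [norm_smul, norm_inv, norm_norm, inv_mul_cancel₀ hN0])
    calc ∫ x, F x * h N * k x N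
        = ∫ x, h N * (F x * √(c - σ x - c * (inner ℝ (‖N‖⁻¹ • N) x / ‖x‖) ^ 2)) := by
          congr 1; funext x
          have e : inner ℝ N x / (‖x‖ * ‖N‖) = inner ℝ (‖N‖⁻¹ • N) x / ‖x‖ := by
            rw [real_inner_smul_left, div_mul_eq_div_div, div_right_comm, div_eq_inv_mul _ ‖N‖]
          simp only [hk, e]
          ring
      _ = 0 := by rw [integral_const_mul, this, mul_zero]
  rw [hR] at hswap
  have h3 : (2 * p + 3 : ℝ)⁻¹ ≠ 0 := by positivity
  refine (mul_eq_zero_iff_left h3).1 ?_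
  rw [← integral_const_mul, ← hswap]
  refine integral_congr_ae ?_
  filter_upwards [hne] with x hx
  have hx0 : ‖x‖ ≠ 0 := norm_ne_zero_iff.2 hx
  have key := integral_ball_inner_pow_mul_zonal (e := ‖x‖⁻¹ • x)
    (by rw [norm_smul, norm_inv, norm_norm, inv_mul_cancel₀ hx0]) b p
    (κ := fun y => √(c - σ x - c * y)) (by fun_prop) (C := √c) (fun y hy => by
      rw [abs_of_nonneg (Real.sqrt_nonneg _)]
      refine Real.sqrt_le_sqrt ?_
      have := hσ0 x
      have : 0 ≤ c * y := by positivity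
      linarith)
  have e0 : inner ℝ b (‖x‖⁻¹ • x) = inner ℝ b x / ‖x‖ := by
    rw [real_inner_smul_right, div_eq_inv_mul]
  rw [e0] at key
  rw [mul_left_comm, ← key, ← integral_const_mul]
  congr 1; funext N
  have e : inner ℝ N x / (‖x‖ * ‖N‖) = inner ℝ (‖x‖⁻¹ • x) N / ‖N‖ := by
    rw [real_inner_smul_left, div_mul_eq_div_div, div_eq_inv_mul _ ‖x‖, real_inner_comm]
  simp only [hk, hh, e]
  ring

theorem abs_inner_div_norm_le (b x : R3) : |inner ℝ b x / ‖x‖| ≤ ‖b‖ := by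
  rw [abs_div, abs_norm]
  exact div_le_of_le_mul₀ (norm_nonneg _) (norm_nonneg _) (abs_real_inner_le_norm b x)

theorem integrable_mul_inner_pow (hF : Integrable F) (b : R3) (m : ℕ) :
    Integrable fun x => F x * (inner ℝ b x / ‖x‖) ^ m := by
  refine hF.mul_bdd (c := ‖b‖ ^ m) ?_ (ae_of_all _ fun x => ?_)
  · exact (by fun_prop : Measurable fun x : R3 => (inner ℝ b x / ‖x‖) ^ m).aestronglyMeasurable
  · rw [norm_pow, Real.norm_eq_abs]
    gcongr
    exact abs_inner_div_norm_le b x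

theorem integrable_mul_comp (hF : Integrable F) (hσ : Measurable σ) (hσ0 : ∀ x, 0 ≤ σ x)
    {c₀ : ℝ} {q : ℝ → ℝ} (hq : Continuous q) (hq0 : ∀ y, c₀ ≤ y → q y = 0) :
    Integrable fun x => F x * q (σ x) := by
  obtain ⟨C, hC⟩ := isCompact_Icc.exists_bound_of_continuousOn (s := Icc 0 c₀) hq.continuousOn
  refine hF.mul_bdd (c := |C|) (hq.measurable.comp hσ).aestronglyMeasurable
    (ae_of_all _ fun x => ?_)
  rcases le_total c₀ (σ x) with h | h
  · rw [hq0 _ h, norm_zero]; positivity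
  · exact (hC _ ⟨hσ0 x, h⟩).trans (le_abs_self C)

/-- Moments in a direction vanish when all zonal relations up to the level `c₀` hold. -/
theorem integral_inner_pow_eq_zero (hFm : Measurable F) (hF : Integrable F) (hσ : Measurable σ)
    (hσ0 : ∀ x, 0 ≤ σ x) {c₀ c₁ : ℝ} (hc₁ : 0 < c₁) (hsupp : ∀ x, F x ≠ 0 → c₁ ≤ σ x)
    (hV : ∀ c, 0 < c → c ≤ c₀ → ∀ n : R3, ‖n‖ = 1 →
      ∫ x, F x * √(c - σ x - c * (inner ℝ n x / ‖x‖) ^ 2) = 0) (b : R3) (p : ℕ) :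
    ∀ q : ℝ → ℝ, Continuous q → (∀ y, c₀ ≤ y → q y = 0) →
      ∫ x, F x * (inner ℝ b x / ‖x‖) ^ (2 * p) * q (σ x) = 0 := by
  induction p using Nat.strong_induction_on with
  | _ p ih =>
  set u : R3 → ℝ := fun x => inner ℝ b x / ‖x‖ with hu
  set G : R3 → ℝ := fun x => F x * u x ^ (2 * p) with hG
  have hGi : Integrable G := integrable_mul_inner_pow hF b (2 * p)
  have hGm : Measurable G := hFm.mul (by fun_prop)
  have hGs : ∀ x, G x ≠ 0 → c₁ ≤ σ x := fun x hx => hsupp x (left_ne_zero_of_mul hx)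
  have hred : ∀ q : ℝ → ℝ, Continuous q → (∀ y, c₀ ≤ y → q y = 0) → ∀ j ≤ p,
      Integrable (fun x => F x * (u x ^ (2 * (p - j)) * (‖b‖ ^ 2 - u x ^ 2) ^ j) * q (σ x)) ∧
      ∫ x, F x * (u x ^ (2 * (p - j)) * (‖b‖ ^ 2 - u x ^ 2) ^ j) * q (σ x) =
        (-1) ^ j * ∫ x, G x * q (σ x) := by
    intro q hq hq0 j hj
    have e : ∀ x, F x * (u x ^ (2 * (p - j)) * (‖b‖ ^ 2 - u x ^ 2) ^ j) * q (σ x) =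
        ∑ l ∈ Finset.range (j + 1), ((-1) ^ l * (‖b‖ ^ 2) ^ (j - l) * j.choose l) *
          (F x * u x ^ (2 * (p - j + l)) * q (σ x)) := by
      intro x
      rw [sub_eq_neg_add, add_pow, Finset.mul_sum, Finset.mul_sum, Finset.sum_mul]
      refine Finset.sum_congr rfl fun l _ => ?_
      rw [neg_pow (u x ^ 2) l, Nat.mul_add, pow_add, pow_mul (u x) 2 l]
      ring
    have hi : ∀ l, Integrable fun x => F x * u x ^ (2 * (p - j + l)) * q (σ x) := fun l =>
      integrable_mul_comp (integrable_mul_inner_pow hF b _) hσ hσ0 hq hq0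
    simp only [e]
    refine ⟨integrable_finsetSum _ fun l _ => (hi l).const_mul _, ?_⟩
    rw [integral_finsetSum _ fun l _ => (hi l).const_mul _, Finset.sum_range_succ]
    simp only [integral_const_mul]
    rw [Finset.sum_eq_zero, zero_add, Nat.sub_add_cancel hj]
    · simp [hG]
    · intro l hl
      rw [ih (p - j + l) (by have := Finset.mem_range.1 hl; omega) q hq hq0, mul_zero]
  set w : ℕ → ℝ := fun j => (2 * p).choose (2 * j) * ∫ θ in (-π)..π, cos θ ^ (2 * j) with hw
  set P : ℕ → Polynomial ℝ := fun j => Polynomial.X ^ (p - j) * (1 - Polynomial.X) ^ j with hP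
  have hPdeg : ∀ j ≤ p, (P j).natDegree ≤ p := by
    intro j hj
    have : (1 - Polynomial.X : Polynomial ℝ).natDegree ≤ 1 := by compute_degree
    have h2 := Polynomial.natDegree_pow_le_of_le j this
    have h1 : (Polynomial.X ^ (p - j) : Polynomial ℝ).natDegree ≤ p - j := by simp
    exact (Polynomial.natDegree_mul_le_of_le h1 h2).trans (by omega)
  set Q : ℕ → ℝ := fun i => (∑ j ∈ Finset.range (p + 1), w j * (-1) ^ j * (P j).coeff i) *
    semicircleMoment i with hQ
  have hQ0 : Q 0 ≠ 0 := by
    have : ∑ j ∈ Finset.range (p + 1), w j * (-1) ^ j * (P j).coeff 0 = w p * (-1) ^ p := by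
      rw [Finset.sum_range_succ, Finset.sum_eq_zero, zero_add]
      · simp [hP, Polynomial.coeff_zero_eq_eval_zero]
      · intro j hj
        have : p - j ≠ 0 := by have := Finset.mem_range.1 hj; omega
        simp [hP, Polynomial.coeff_zero_eq_eval_zero, this]
    have hch : ((2 * p).choose (2 * p) : ℝ) ≠ 0 := by simp
    change (∑ j ∈ Finset.range (p + 1), w j * (-1) ^ j * (P j).coeff 0) * semicircleMoment 0 ≠ 0
    rw [this]
    exact mul_ne_zero (mul_ne_zero (mul_ne_zero hch (integral_cos_pow_even_pos p).ne')
      (pow_ne_zero _ (by norm_num))) semicircleMoment_zero_pos.ne'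
  have hmom : ∀ c ≤ c₀, ∫ x, G x * max (c - σ x) 0 = 0 := by
    intro c hc
    refine truncatedMoment_one_eq_zero hGi hσ hσ0 hc₁ hGs hQ0 (p := p) (fun c hc0 hcc => ?_) hc
    have havg := integral_zonal_average_eq_zero hF hσ hσ0 hc0 (hV c hc0 hcc) b p
    set q : ℕ → ℝ → ℝ := fun j y => ∑ i ∈ Finset.range (p + 1), (P j).coeff i *
      (semicircleMoment i / √c * (c⁻¹ ^ i * max (c - y) 0 ^ (i + 1))) with hq
    have hqc : ∀ j, Continuous (q j) := fun j => by simp only [hq]; fun_prop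
    have hq0 : ∀ j y, c₀ ≤ y → q j y = 0 := by
      intro j y hy
      refine Finset.sum_eq_zero fun i _ => ?_
      rw [max_eq_right (by linarith)]; simp
    have e1 : ∀ x, F x * ∑ j ∈ Finset.range (p + 1), (2 * p).choose (2 * j) *
        (u x ^ (2 * (p - j)) * (‖b‖ ^ 2 - u x ^ 2) ^ j) *
        (∫ θ in (-π)..π, cos θ ^ (2 * j)) *
        (∫ t in (-1 : ℝ)..1, (t ^ 2) ^ (p - j) * (1 - t ^ 2) ^ j * √(c - σ x - c * t ^ 2)) =
        ∑ j ∈ Finset.range (p + 1), w j *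
          (F x * (u x ^ (2 * (p - j)) * (‖b‖ ^ 2 - u x ^ 2) ^ j) * q j (σ x)) := by
      intro x
      rw [Finset.mul_sum]
      refine Finset.sum_congr rfl fun j hj => ?_
      have hj' : j ≤ p := Nat.lt_succ_iff.1 (Finset.mem_range.1 hj)
      have := integral_eval_mul_sqrt hc0 (hσ0 x) (P j) (hPdeg j hj')
      simp only [hP, Polynomial.eval_mul, Polynomial.eval_pow, Polynomial.eval_X,
        Polynomial.eval_sub, Polynomial.eval_one] at this
      rw [this]
      simp only [hq, hw, hP]
      ring
    replace havg := (integral_congr_ae (ae_of_all _ e1)).symm.trans havg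
    rw [integral_finsetSum _ fun j hj => ((hred (q j) (hqc j) (hq0 j) j
      (Nat.lt_succ_iff.1 (Finset.mem_range.1 hj))).1.const_mul _)] at havg
    simp only [integral_const_mul] at havg
    have hsq : √c ≠ 0 := (Real.sqrt_pos.2 hc0).ne'
    refine (mul_eq_zero_iff_left (inv_ne_zero hsq)).1 (Eq.trans ?_ havg)
    have hm := integrable_truncated hGi hσ hσ0
    rw [Finset.mul_sum]
    calc ∑ i ∈ Finset.range (p + 1), (√c)⁻¹ * (Q i * c⁻¹ ^ i * ∫ x, G x * max (c - σ x) 0 ^ (i + 1))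
        = ∑ i ∈ Finset.range (p + 1), ∑ j ∈ Finset.range (p + 1),
          w j * ((-1) ^ j * ((P j).coeff i * (semicircleMoment i / √c * (c⁻¹ ^ i *
            ∫ x, G x * max (c - σ x) 0 ^ (i + 1))))) := by
          refine Finset.sum_congr rfl fun i _ => ?_
          simp only [hQ, Finset.sum_mul, Finset.mul_sum]
          refine Finset.sum_congr rfl fun j _ => ?_
          ring
      _ = _ := by
          rw [Finset.sum_comm]
          refine Finset.sum_congr rfl fun j hj => ?_
          rw [(hred (q j) (hqc j) (hq0 j) j (Nat.lt_succ_iff.1 (Finset.mem_range.1 hj))).2,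
            ← Finset.mul_sum, ← Finset.mul_sum]
          congr 2
          simp only [hq, Finset.mul_sum]
          rw [integral_finsetSum _ fun i _ => ?_]
          · refine Finset.sum_congr rfl fun i _ => ?_
            simp only [← integral_const_mul]
            congr 1; funext x; ring
          · have := (hm (i + 1) c).const_mul
              ((P j).coeff i * (semicircleMoment i / √c * c⁻¹ ^ i))
            refine this.congr (ae_of_all _ fun x => ?_)
            ring
  intro q hq hq0
  exact integral_comp_eq_zero_of_truncated hGm hGi hσ hσ0 hmom hq.measurable hq0
    (integrable_mul_comp hGi hσ hσ0 hq hq0)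

end ZonalInversion

theorem continuous_intervalIntegral_swap {g : ℝ → ℝ → ℝ} (hg : Continuous (Function.uncurry g))
    (a b c d : ℝ) :
    ∫ x in a..b, ∫ y in c..d, g x y = ∫ y in c..d, ∫ x in a..b, g x y := by
  refine intervalIntegral_intervalIntegral_swap ?_
  exact (hg.continuousOn.integrableOn_compact (isCompact_uIcc.prod isCompact_uIcc)).mono_set
    (prod_mono uIoc_subset_uIcc uIoc_subset_uIcc)

/-- Signed height parameter of the sphere of radius `ρ`. -/
def heightOf (ρ : ℝ) : ℝ := (ρ - ρ⁻¹) / 2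

/-- Radius with height parameter `s`, inverse to `heightOf` on positive radii. -/
def radiusOf (s : ℝ) : ℝ := √(s ^ 2 + 1) + s

theorem radiusOf_pos (s : ℝ) : 0 < radiusOf s := by
  have : |s| < √(s ^ 2 + 1) := by
    rw [← Real.sqrt_sq_eq_abs]
    exact Real.sqrt_lt_sqrt (sq_nonneg s) (by linarith)
  unfold radiusOf
  linarith [neg_abs_le s]

theorem continuous_radiusOf : Continuous radiusOf := by unfold radiusOf; fun_prop

theorem heightOf_radiusOf (s : ℝ) : heightOf (radiusOf s) = s := by
  have h := Real.sq_sqrt (by positivity : 0 ≤ s ^ 2 + 1)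
  have : (radiusOf s)⁻¹ = √(s ^ 2 + 1) - s := by
    refine inv_eq_of_mul_eq_one_right ?_
    unfold radiusOf
    linear_combination h
  rw [heightOf, this, radiusOf]; ring

theorem radiusOf_heightOf {ρ : ℝ} (hρ : 0 < ρ) : radiusOf (heightOf ρ) = ρ := by
  have : √(heightOf ρ ^ 2 + 1) = (ρ + ρ⁻¹) / 2 := by
    rw [show heightOf ρ ^ 2 + 1 = ((ρ + ρ⁻¹) / 2) ^ 2 by
      unfold heightOf; field_simp; ring, Real.sqrt_sq (by positivity)]
  rw [radiusOf, this, heightOf]; ring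

theorem heightOf_lt_heightOf {a b : ℝ} (ha : 0 < a) (hab : a < b) : heightOf a < heightOf b := by
  have := inv_strictAnti₀ ha hab
  unfold heightOf
  linarith

theorem heightOf_one : heightOf 1 = 0 := by simp [heightOf]

theorem heightOf_pos {ρ : ℝ} (hρ : 1 < ρ) : 0 < heightOf ρ := by
  have := heightOf_lt_heightOf one_pos hρ
  rwa [heightOf_one] at this

theorem one_lt_radiusOf {s : ℝ} (hs : 0 < s) : 1 < radiusOf s := by
  by_contra! h
  rcases h.lt_or_eq with h | h
  · have := heightOf_lt_heightOf (radiusOf_pos s) h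
    rw [heightOf_one, heightOf_radiusOf] at this
    linarith
  · have := heightOf_radiusOf s
    rw [h, heightOf_one] at this
    linarith

theorem measurable_heightOf : Measurable heightOf := by unfold heightOf; fun_prop

theorem hasDerivAt_radiusOf (s : ℝ) :
    HasDerivAt radiusOf (radiusOf s / √(s ^ 2 + 1)) s := by
  have hp : 0 < s ^ 2 + 1 := by positivity
  have h := ((((hasDerivAt_id s).pow 2).add_const 1).sqrt (by simpa using hp.ne')).add
    (hasDerivAt_id s)
  convert! h using 1
  have hs := Real.sq_sqrt hp.le
  have hs0 : √(s ^ 2 + 1) ≠ 0 := (Real.sqrt_pos.2 hp).ne'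
  simp [radiusOf]
  field_simp
  ring

/-- The radial substitution along a meridian. -/
theorem integral_Ioi_one_eq {a : ℝ} (ha : 0 < a) (k : ℝ → ℝ) :
    ∫ ρ in Ioi (1 : ℝ), k ρ = ∫ r in Ioi (0 : ℝ),
      a * (radiusOf (r * a) / √((r * a) ^ 2 + 1)) * k (radiusOf (r * a)) := by
  have him : (fun r => radiusOf (r * a)) '' Ioi 0 = Ioi 1 := by
    ext ρ
    constructor
    · rintro ⟨r, hr, rfl⟩
      exact one_lt_radiusOf (mul_pos hr ha)
    · intro hρ
      refine ⟨heightOf ρ / a, div_pos (heightOf_pos hρ) ha, ?_⟩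
      simp only [div_mul_cancel₀ _ ha.ne']
      exact radiusOf_heightOf (one_pos.trans hρ)
  have hinj : InjOn (fun r => radiusOf (r * a)) (Ioi 0) := by
    intro r _ r' _ h
    have := congrArg heightOf h
    simpa [heightOf_radiusOf, ha.ne'] using this
  have hd : ∀ r ∈ Ioi (0 : ℝ), HasDerivWithinAt (fun r => radiusOf (r * a))
      (radiusOf (r * a) / √((r * a) ^ 2 + 1) * a) (Ioi 0) r := fun r _ =>
    (HasDerivAt.comp (h := fun r => r * a) r (hasDerivAt_radiusOf (r * a))
      (hasDerivAt_mul_const a)).hasDerivWithinAt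
  rw [← him, integral_image_eq_integral_abs_deriv_smul measurableSet_Ioi hd hinj]
  refine setIntegral_congr_fun measurableSet_Ioi fun r _ => ?_
  have := radiusOf_pos (r * a)
  simp only [smul_eq_mul]
  rw [abs_of_nonneg (by positivity)]
  ring

/-- The square of the height parameter of a point. -/
def levelOf (x : R3) : ℝ := heightOf ‖x‖ ^ 2

theorem measurable_levelOf : Measurable levelOf :=
  (measurable_heightOf.comp measurable_norm).pow_const 2

theorem levelOf_nonneg (x : R3) : 0 ≤ levelOf x := sq_nonneg _

section Weighted

variable {f : R3 → ℝ} {ε₁ ε₂ : ℝ}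

theorem levelOf_ge (hε₁ : 1 < ε₁) (hf0 : ∀ x, f x ≠ 0 → ε₁ < ‖x‖ ∧ ‖x‖ < ε₂) (x : R3)
    (hx : f x ≠ 0) : heightOf ε₁ ^ 2 ≤ levelOf x := by
  have h1 := heightOf_pos hε₁
  have := heightOf_lt_heightOf (one_pos.trans hε₁) (hf0 x hx).1
  unfold levelOf
  gcongr

theorem measurable_weighted (hf : Continuous f) :
    Measurable fun x => f x / (levelOf x * ‖x‖) :=
  hf.measurable.div (measurable_levelOf.mul measurable_norm)

theorem abs_weighted_le {C : ℝ} (hε₁ : 1 < ε₁) (hf0 : ∀ x, f x ≠ 0 → ε₁ < ‖x‖ ∧ ‖x‖ < ε₂)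
    (hC : ∀ x, |f x| ≤ C) (x : R3) :
    |f x / (levelOf x * ‖x‖)| ≤ C / heightOf ε₁ ^ 2 := by
  have hp : 0 < heightOf ε₁ := heightOf_pos hε₁
  have hC0 : 0 ≤ C := (abs_nonneg _).trans (hC x)
  by_cases hx : f x = 0
  · rw [hx, zero_div, abs_zero]; positivity
  · have h1 := levelOf_ge hε₁ hf0 x hx
    have h2 : 1 ≤ ‖x‖ := (hε₁.trans (hf0 x hx).1).le
    rw [abs_div, abs_of_nonneg (mul_nonneg (levelOf_nonneg x) (norm_nonneg x))]
    refine div_le_div₀ hC0 (hC x) (by positivity) ?_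
    nlinarith [sq_nonneg (heightOf ε₁)]

theorem integrable_weighted {C : ℝ} (hf : Continuous f) (hε₁ : 1 < ε₁)
    (hf0 : ∀ x, f x ≠ 0 → ε₁ < ‖x‖ ∧ ‖x‖ < ε₂) (hC : ∀ x, |f x| ≤ C) :
    Integrable fun x => f x / (levelOf x * ‖x‖) := by
  refine integrable_of_bounded_support (measurable_weighted hf) (B := Metric.closedBall 0 ε₂)
    measurableSet_closedBall measure_closedBall_lt_top (abs_weighted_le hε₁ hf0 hC) fun x hx => ?_
  by_cases h : f x = 0
  · simp [h]
  · exact absurd (by simpa using (hf0 x h).2.le) hx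

/-- The Abel-type weighted average of the apple transform is a zonal integral. -/
theorem integral_zonal_eq_zero_of_appleT {C : ℝ} (hf : Continuous f) (hε₁ : 1 < ε₁)
    (hf0 : ∀ x, f x ≠ 0 → ε₁ < ‖x‖ ∧ ‖x‖ < ε₂) (hC : ∀ x, |f x| ≤ C) {c : ℝ} (hc : 0 < c)
    {α β : ℝ} (hA : ∀ r ∈ Icc 0 √c, appleT f r α β = 0) :
    ∫ x, f x / (levelOf x * ‖x‖) *
      √(c - levelOf x - c * (inner ℝ (rotUV α β northPole) x / ‖x‖) ^ 2) = 0 := by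
  set Q := rotUVIso α β with hQ
  have hs1 : 0 < heightOf ε₁ := heightOf_pos hε₁
  have hlev : ∀ x, levelOf (Q x) = levelOf x := fun x => by simp [levelOf, Q.norm_map]
  have hin : ∀ x, inner ℝ (rotUV α β northPole) (Q x) = x 2 := fun x => by
    rw [← rotUVIso_apply, ← hQ, Q.inner_map_map, inner_northPole]
  rw [← integral_comp_isometry Q]
  simp only [hlev, hin, Q.norm_map]
  have hC0 : 0 ≤ C := (abs_nonneg _).trans (hC 0)
  have hm : Measurable fun x => f (Q x) / (levelOf x * ‖x‖) *
      √(c - levelOf x - c * (x 2 / ‖x‖) ^ 2) := by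
    have h1 : Measurable fun x => f (Q x) := (hf.comp Q.continuous).measurable
    have h2 := measurable_levelOf
    have h3 : Measurable fun x : R3 => x 2 := by fun_prop
    exact (h1.div (h2.mul measurable_norm)).mul
      (((h2.const_sub c).sub (((h3.div measurable_norm).pow_const 2).const_mul c)).sqrt)
  rw [integral_spherical hm (C := C / heightOf ε₁ ^ 2 * √c) (R := ε₂)]
  rotate_left
  · intro x
    have h1 := abs_weighted_le hε₁ hf0 hC (Q x)
    rw [hlev, Q.norm_map] at h1
    rw [abs_mul, abs_of_nonneg (Real.sqrt_nonneg _)]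
    refine mul_le_mul h1 (Real.sqrt_le_sqrt ?_) (Real.sqrt_nonneg _) (by positivity)
    have := levelOf_nonneg x
    have : 0 ≤ c * (x 2 / ‖x‖) ^ 2 := by positivity
    linarith
  · intro x hx
    have : f (Q x) = 0 := by
      by_contra h
      have := (hf0 _ h).2
      rw [Q.norm_map] at this
      linarith
    simp [this]
  set g : ℝ → ℝ → ℝ → ℝ := fun r θ φ => radiusOf (r * sin φ) ^ 2 * sin φ *
    √((1 + r ^ 2) / (1 + r ^ 2 * sin φ ^ 2)) * f (radiusOf (r * sin φ) • Q (sphVec θ φ)) with hg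
  set a : ℝ → ℝ := fun r => √(c - r ^ 2) / (max r (heightOf ε₁) ^ 2 * √(1 + r ^ 2)) with ha
  have hac : Continuous a := by
    refine Continuous.div (by fun_prop) (by fun_prop) fun r => ?_
    have : 0 < max r (heightOf ε₁) := lt_max_of_lt_right hs1
    positivity
  have hsph : Continuous fun z : ℝ × ℝ => sphVec z.1 z.2 := by
    unfold sphVec
    refine (PiLp.continuous_toLp 2 _).comp (continuous_pi fun i => ?_)
    fin_cases i <;> simp <;> fun_prop
  have hgc : Continuous fun z : ℝ × ℝ × ℝ => g z.1 z.2.1 z.2.2 := by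
    have h1 : Continuous fun z : ℝ × ℝ × ℝ => radiusOf (z.1 * sin z.2.2) :=
      continuous_radiusOf.comp (by fun_prop)
    have h2 : Continuous fun z : ℝ × ℝ × ℝ =>
        √((1 + z.1 ^ 2) / (1 + z.1 ^ 2 * sin z.2.2 ^ 2)) :=
      Real.continuous_sqrt.comp (Continuous.div (by fun_prop) (by fun_prop)
        fun z => by positivity)
    have h3 : Continuous fun z : ℝ × ℝ × ℝ => Q (sphVec z.2.1 z.2.2) :=
      Q.continuous.comp (hsph.comp continuous_snd)
    exact (((h1.pow 2).mul (by fun_prop)).mul h2).mul (hf.comp (h1.smul h3))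
  have hrad : ∀ θ, ∀ φ ∈ Ioo 0 π, ∫ ρ in Ioi (0 : ℝ), ρ ^ 2 * sin φ *
      (f (Q (ρ • sphVec θ φ)) / (levelOf (ρ • sphVec θ φ) * ‖ρ • sphVec θ φ‖) *
        √(c - levelOf (ρ • sphVec θ φ) - c * ((ρ • sphVec θ φ) 2 / ‖ρ • sphVec θ φ‖) ^ 2)) =
      ∫ r in (0 : ℝ)..√c, a r * g r θ φ := by
    intro θ φ hφ
    have hsin : 0 < sin φ := sin_pos_of_mem_Ioo hφ
    have hnorm : ∀ ρ, 0 < ρ → ‖ρ • sphVec θ φ‖ = ρ := fun ρ hρ => by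
      rw [norm_smul, norm_sphVec, mul_one, Real.norm_eq_abs, abs_of_pos hρ]
    have hz : ∀ ρ, 0 < ρ → ρ ≤ ε₁ → f (Q (ρ • sphVec θ φ)) = 0 := by
      intro ρ hρ h1
      by_contra h
      have := (hf0 _ h).1
      rw [Q.norm_map, hnorm ρ hρ] at this
      linarith
    rw [setIntegral_eq_of_subset_of_forall_sdiff_eq_zero measurableSet_Ioi
      (Ioi_subset_Ioi zero_le_one), integral_Ioi_one_eq hsin]
    rotate_left
    · rintro ρ ⟨h0, h1⟩
      rw [hz ρ h0 ((not_lt.1 h1).trans hε₁.le)]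
      simp
    rw [intervalIntegral.integral_of_le (Real.sqrt_nonneg c),
      ← setIntegral_eq_of_subset_of_forall_sdiff_eq_zero (t := Ioi 0) (s := Ioc 0 √c)
        (f := fun r => a r * g r θ φ) measurableSet_Ioi Ioc_subset_Ioi_self]
    · refine setIntegral_congr_fun measurableSet_Ioi fun r hr => ?_
      have hr0 : 0 < r := hr
      have hR := radiusOf_pos (r * sin φ)
      simp only [hg, ha]
      rw [← Q.map_smul]
      by_cases h : f (Q (radiusOf (r * sin φ) • sphVec θ φ)) = 0
      · simp only [h, zero_div, zero_mul, mul_zero]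
      have hge := (hf0 _ h).1
      rw [Q.norm_map, hnorm _ hR] at hge
      have hge' := heightOf_lt_heightOf (one_pos.trans hε₁) hge
      rw [heightOf_radiusOf] at hge'
      have hmax : max r (heightOf ε₁) = r := max_eq_left
        (hge'.le.trans (mul_le_of_le_one_right hr0.le (sin_le_one φ)))
      have hlv : levelOf (radiusOf (r * sin φ) • sphVec θ φ) = (r * sin φ) ^ 2 := by
        rw [levelOf, hnorm _ hR, heightOf_radiusOf]
      have c2 : (radiusOf (r * sin φ) • sphVec θ φ) 2 = radiusOf (r * sin φ) * cos φ := by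
        simp [sphVec]
      rw [hmax, hlv, hnorm _ hR, c2, mul_div_cancel_left₀ _ hR.ne',
        show c - (r * sin φ) ^ 2 - c * cos φ ^ 2 = sin φ ^ 2 * (c - r ^ 2) by
          rw [cos_sq']; ring, Real.sqrt_mul (sq_nonneg _), Real.sqrt_sq hsin.le,
        Real.sqrt_div (by positivity), show 1 + r ^ 2 * sin φ ^ 2 = (r * sin φ) ^ 2 + 1 by ring]
      have h5 : √(1 + r ^ 2) ≠ 0 := (Real.sqrt_pos.2 (by positivity)).ne'
      have h6 : √((r * sin φ) ^ 2 + 1) ≠ 0 := (Real.sqrt_pos.2 (by positivity)).ne'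
      field_simp
    · rintro r ⟨h0, h1⟩
      have : √c < r := by
        by_contra! h
        exact h1 ⟨h0, h⟩
      have : c - r ^ 2 ≤ 0 := by
        have := (Real.sqrt_lt' h0).1 this
        linarith
      simp only [ha]
      rw [Real.sqrt_eq_zero_of_nonpos this, zero_div, zero_mul]
  have hagc : Continuous fun z : ℝ × ℝ × ℝ => a z.1 * g z.1 z.2.1 z.2.2 :=
    (hac.comp continuous_fst).mul hgc
  have hF1 : ∀ θ, ∫ φ in Ioo 0 π, ∫ ρ in Ioi (0 : ℝ), ρ ^ 2 * sin φ *
      (f (Q (ρ • sphVec θ φ)) / (levelOf (ρ • sphVec θ φ) * ‖ρ • sphVec θ φ‖) *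
        √(c - levelOf (ρ • sphVec θ φ) - c * ((ρ • sphVec θ φ) 2 / ‖ρ • sphVec θ φ‖) ^ 2)) =
      ∫ r in (0 : ℝ)..√c, ∫ φ in (0 : ℝ)..π, a r * g r θ φ := by
    intro θ
    rw [setIntegral_congr_fun measurableSet_Ioo (hrad θ), ← integral_Ioc_eq_integral_Ioo,
      ← intervalIntegral.integral_of_le pi_pos.le]
    refine continuous_intervalIntegral_swap (g := fun φ r => a r * g r θ φ) ?_ _ _ _ _
    have h : Continuous fun z : ℝ × ℝ => (z.2, θ, z.1) := by fun_prop
    exact hagc.comp h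
  simp only [hF1]
  rw [← integral_Ioc_eq_integral_Ioo, ← intervalIntegral.integral_of_le (by linarith [pi_pos]),
    continuous_intervalIntegral_swap (g := fun θ r => ∫ φ in (0 : ℝ)..π, a r * g r θ φ)]
  · rw [intervalIntegral.integral_congr (g := fun _ => 0), intervalIntegral.integral_zero]
    intro r hr
    rw [uIcc_of_le (Real.sqrt_nonneg c)] at hr
    simp only [intervalIntegral.integral_const_mul]
    have hper : Function.Periodic (fun θ => ∫ φ in (0 : ℝ)..π, g r θ φ) (2 * π) := by
      intro θ
      have : ∀ φ, sphVec (θ + 2 * π) φ = sphVec θ φ := fun φ => by simp [sphVec]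
      simp only [hg, this]
    have hshift := hper.intervalIntegral_add_eq (-π) 0
    rw [show -π + 2 * π = π by ring, zero_add] at hshift
    rw [hshift]
    refine mul_eq_zero_of_right _ ((hA r hr).symm.trans ?_).symm
    simp only [appleT, hg, radiusOf, mul_pow]
    rfl
  · refine intervalIntegral.continuous_parametric_intervalIntegral_of_continuous' ?_ _ _
    have h : Continuous fun z : (ℝ × ℝ) × ℝ => (z.1.2, z.1.1, z.2) := by fun_prop
    exact hagc.comp h

end Weighted

/-- The even part of a continuous compactly supported function is determined by the moments
against even powers of linear forms. -/
theorem add_comp_neg_eq_zero_of_moments {H : R3 → ℝ} (hH : Continuous H)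
    (hHc : HasCompactSupport H)
    (hmom : ∀ (b : R3) (p : ℕ), ∫ x, H x * inner ℝ b x ^ (2 * p) = 0) (x : R3) :
    H x + H (-x) = 0 := by
  obtain ⟨R, hR⟩ := hHc.isCompact.isBounded.exists_norm_le
  have hHi : Integrable H := hH.integrable_of_hasCompactSupport hHc
  have hcos : ∀ b : R3, ∫ x, H x * cos (inner ℝ b x) = 0 := by
    intro b
    set T : ℕ → R3 → ℝ := fun p x => H x * ((-1) ^ p * inner ℝ b x ^ (2 * p) / (2 * p).factorial)
      with hT
    have hTc : ∀ p, Integrable (T p) := fun p =>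
      (by simp only [hT]; fun_prop : Continuous (T p)).integrable_of_hasCompactSupport
        hHc.mul_right
    have hbound : ∀ p, ∫ x, ‖T p x‖ ≤
        (∫ x, ‖H x‖) * ((‖b‖ * |R|) ^ (2 * p) / (2 * p).factorial) := by
      intro p
      rw [← integral_mul_const]
      refine integral_mono (hTc p).norm (hHi.norm.mul_const _) fun x => ?_
      simp only [hT]
      rw [norm_mul]
      by_cases hx : H x = 0
      · simp [hx]
      have hxR : ‖x‖ ≤ |R| := (hR x (subset_tsupport H hx)).trans (le_abs_self R)
      refine mul_le_mul_of_nonneg_left ?_ (norm_nonneg _)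
      rw [norm_div, norm_mul, norm_pow, norm_pow, norm_neg, norm_one, one_pow, one_mul,
        Real.norm_natCast]
      gcongr
      exact (abs_real_inner_le_norm b x).trans (by gcongr)
    have hsum : Summable fun p => ∫ x, ‖T p x‖ := by
      refine Summable.of_nonneg_of_le (fun p => integral_nonneg fun x => norm_nonneg _) hbound ?_
      exact ((Real.summable_pow_div_factorial (‖b‖ * |R|)).comp_injective
        (mul_right_injective₀ two_ne_zero)).mul_left _
    have h1 := integral_tsum_of_summable_integral_norm hTc hsum
    have h2 : ∀ x, ∑' p, T p x = H x * cos (inner ℝ b x) := fun x =>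
      ((Real.hasSum_cos (inner ℝ b x)).mul_left (H x)).tsum_eq
    have h3 : ∀ p, ∫ x, T p x = 0 := by
      intro p
      have e : ∀ x, T p x = (H x * inner ℝ b x ^ (2 * p)) * ((-1) ^ p / (2 * p).factorial) :=
        fun x => by simp only [hT]; ring
      simp only [e]
      rw [integral_mul_const, hmom, zero_mul]
    simp only [h2, h3, tsum_zero] at h1
    exact h1.symm
  set g : R3 → ℂ := fun x => ((H x : ℝ) : ℂ) + ((H (-x) : ℝ) : ℂ) with hg
  have hgc : Continuous g := by simp only [hg]; fun_prop
  have hgi : Integrable g := hHi.ofReal.add hHi.comp_neg.ofReal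
  have hF : FourierTransform.fourier g = 0 := by
    funext w
    rw [Real.fourier_eq]
    have hi1 : Integrable fun v : R3 => (Real.fourierChar (-inner ℝ v w)) • ((H v : ℝ) : ℂ) :=
      (Real.fourierIntegral_convergent_iff w).2 hHi.ofReal
    have hi2 : Integrable fun v : R3 => (Real.fourierChar (-inner ℝ v w)) • ((H (-v) : ℝ) : ℂ) :=
      (Real.fourierIntegral_convergent_iff w).2 hHi.comp_neg.ofReal
    have hneg := integral_neg_eq_self
      (fun v : R3 => (Real.fourierChar (-inner ℝ v w)) • ((H (-v) : ℝ) : ℂ)) volume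
    have hi3 := hi2.comp_neg
    simp only [hg, smul_add]
    rw [integral_add hi1 hi2, ← hneg, ← integral_add hi1 hi3, Pi.zero_apply]
    have e : ∀ v : R3, (Real.fourierChar (-inner ℝ v w)) • ((H v : ℝ) : ℂ) +
        (Real.fourierChar (-inner ℝ (-v) w)) • ((H (- -v) : ℝ) : ℂ) =
        ((2 * (H v * cos (inner ℝ ((2 * π) • w) v)) : ℝ) : ℂ) := by
      intro v
      rw [neg_neg, inner_neg_left, neg_neg, real_inner_smul_left, real_inner_comm w v,
        Circle.smul_def, Circle.smul_def, Real.fourierChar_apply, Real.fourierChar_apply]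
      push_cast
      rw [Complex.cos]
      simp only [smul_eq_mul]
      rw [show ((2 * π * -(inner ℝ w v : ℝ) : ℂ)) * Complex.I =
        -(2 * π * (inner ℝ w v : ℝ)) * Complex.I by ring]
      ring
    simp only [e]
    rw [integral_complex_ofReal, integral_const_mul, hcos, mul_zero, Complex.ofReal_zero]
  have hinv := hgc.fourierInv_fourier_eq hgi (by rw [hF]; exact integrable_zero _ _ _)
  have hx := congrFun hinv x
  rw [hF, Real.fourierInv_eq] at hx
  simp only [Pi.zero_apply, smul_zero, integral_zero, hg] at hx
  exact_mod_cast hx.symm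

/-- Theorem 5 of the paper: the apple transform on `0 ≤ r ≤ δ` determines
a smooth function supported exterior to the unit ball, in `B_{ε₁,ε₂} ∩ U`, uniquely for
`1 ≤ |x| ≤ ε`. -/
theorem apple_transform_determines
    (ε₁ ε₂ : ℝ) (hε₁ : 1 < ε₁) (h₁₂ : ε₁ < ε₂)
    (f : R3 → ℝ) (hf : ContDiff ℝ (⊤ : ℕ∞) f) (hfc : HasCompactSupport f)
    (hsupp : tsupport f ⊆ hollowBall ε₁ ε₂ ∩ upperHalf)
    (ε : ℝ) (hε : ε₁ ≤ ε ∧ ε ≤ ε₂) (δ : ℝ) (hδ : δ = (ε ^ 2 - 1) / (2 * ε))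
    (hA : ∀ r ∈ Icc (0:ℝ) δ, ∀ α ∈ Icc (0:ℝ) (2 * π), ∀ β ∈ Icc (0:ℝ) π,
      appleT f r α β = 0) :
    ∀ x : R3, 1 ≤ ‖x‖ → ‖x‖ ≤ ε → f x = 0 := by
  have hε1 : 1 < ε := hε₁.trans_le hε.1
  have hδh : δ = heightOf ε := by
    have : ε ≠ 0 := by linarith
    rw [hδ, heightOf]; field_simp
  have hδ0 : 0 < δ := hδh ▸ heightOf_pos hε1
  have hfcont : Continuous f := hf.continuous
  have hf0 : ∀ x, f x ≠ 0 → ε₁ < ‖x‖ ∧ ‖x‖ < ε₂ := fun x hx => (hsupp (subset_tsupport f hx)).1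
  have hfU : ∀ x, f x ≠ 0 → 0 < x 2 := fun x hx => (hsupp (subset_tsupport f hx)).2
  obtain ⟨C, hC⟩ := hfc.exists_bound_of_continuous hfcont
  have hFi := integrable_weighted hfcont hε₁ hf0 hC
  have hV : ∀ c, 0 < c → c ≤ δ ^ 2 → ∀ n : R3, ‖n‖ = 1 → ∫ x, f x / (levelOf x * ‖x‖) *
      √(c - levelOf x - c * (inner ℝ n x / ‖x‖) ^ 2) = 0 := by
    intro c hc hcδ n hn
    obtain ⟨α, hα, β, hβ, rfl⟩ := exists_rotUV_northPole hn
    refine integral_zonal_eq_zero_of_appleT hfcont hε₁ hf0 hC hc fun r hr => ?_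
    exact hA r ⟨hr.1, hr.2.trans (Real.sqrt_le_iff.2 ⟨hδ0.le, hcδ⟩)⟩ α hα β hβ
  have hmom := integral_inner_pow_eq_zero (measurable_weighted hfcont) hFi measurable_levelOf
    levelOf_nonneg (pow_pos (heightOf_pos hε₁) 2)
    (fun x hx => levelOf_ge hε₁ hf0 x fun h => hx (by rw [h, zero_div])) hV
  set H : R3 → ℝ := fun x => f x * max (δ ^ 2 - heightOf (max ‖x‖ 1) ^ 2) 0 with hH
  have hHc : Continuous H := by
    have : Continuous fun x : R3 => (max ‖x‖ 1)⁻¹ := Continuous.inv₀ (by fun_prop)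
      fun x => (one_pos.trans_le (le_max_right _ _)).ne'
    simp only [hH, heightOf]
    fun_prop
  have hHm : ∀ (b : R3) (p : ℕ), ∫ x, H x * inner ℝ b x ^ (2 * p) = 0 := by
    intro b p
    have := hmom b p (fun y => max (δ ^ 2 - y) 0 * (y * radiusOf √y ^ (2 * p + 1)))
      (by have := continuous_radiusOf; fun_prop)
      (fun y hy => by rw [max_eq_right (by linarith), zero_mul])
    refine Eq.trans ?_ this
    congr 1; funext x
    by_cases hx : f x = 0
    · simp [hH, hx]
    have h1 : 1 < ‖x‖ := hε₁.trans (hf0 x hx).1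
    have h0 : ‖x‖ ≠ 0 := by linarith
    have hh := heightOf_pos h1
    simp only [hH]
    rw [max_eq_left h1.le, levelOf, Real.sqrt_sq hh.le, radiusOf_heightOf (by linarith), div_pow]
    field_simp
    ring
  have hball : Metric.ball (0 : R3) ε ⊆ {x | f x = 0} := by
    intro x hx
    by_contra h
    have hxε : ‖x‖ < ε := by simpa using hx
    have h1 : 1 < ‖x‖ := hε₁.trans (hf0 x h).1
    have hneg : f (-x) = 0 := by
      by_contra h'
      have h2 := hfU _ h'
      have := hfU _ h
      rw [PiLp.neg_apply] at h2
      linarith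
    have hsum := add_comp_neg_eq_zero_of_moments hHc hfc.mul_right hHm x
    simp only [hH, hneg, zero_mul, add_zero] at hsum
    have hlt := heightOf_lt_heightOf (one_pos.trans h1) hxε
    have hpos := heightOf_pos h1
    rw [max_eq_left h1.le] at hsum
    rw [← hδh] at hlt
    have : 0 < δ ^ 2 - heightOf ‖x‖ ^ 2 := by nlinarith
    exact mul_ne_zero h (lt_max_of_lt_left this).ne' hsum
  intro x _ hxε
  have hcl := closure_minimal hball (isClosed_eq hfcont continuous_const)
  rw [closure_ball _ (by linarith)] at hcl
  exact hcl (by simpa using hxε)
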